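/- Let q_0 be a prime power, q = q_0^2, n ≥ 2, V = GF(q)^n, and let D be a nontrivial 2-(q^n,k,2) design with point set V and even replication number r, admitting a flag-transitive, point-primitive automorphism group G = T ⋊ G_0, where T is the translation group of V, G_0 ≤ ΓL_n(q), n is minimal such that G_0 is contained in ΓL_n(q) in its natural action on V, and G_0 contains as a normal subgroup the special unitary group SU_n(q_0) of a nondegenerate Hermitian form on V. Then n = 2, q_0 ∈ {2,3}, and (v,k,r) = (16,6,6) or (81,6,32) respectively. -/

import Mathlib

open Matrix

/-- A permutation of a `K`-vector space `V` is semilinear if it is additive and twists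
scalars by a field automorphism (i.e. it belongs to `ΓL(V)`). -/
def IsSemilinearPerm (K : Type*) {V : Type*} [Field K] [AddCommGroup V] [Module K V]
    (σ : Equiv.Perm V) : Prop :=
  (∀ x y : V, σ (x + y) = σ x + σ y) ∧
  ∃ τ : K ≃+* K, ∀ (c : K) (x : V), σ (c • x) = τ c • σ x


/-! ### Design counting -/

lemma design_rk {V : Type*} [Fintype V] [DecidableEq V] (𝓑 : Finset (Finset V)) (k r : ℕ)
    (hk : ∀ B ∈ 𝓑, B.card = k)
    (hlam : ∀ x y : V, x ≠ y → (𝓑.filter (fun B => x ∈ B ∧ y ∈ B)).card = 2)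
    (hr : ∀ x : V, (𝓑.filter (fun B => x ∈ B)).card = r) (x : V) (hk1 : 1 ≤ k) :
    r * (k - 1) = 2 * (Fintype.card V - 1) := by
  have h1 := Finset.sum_card_bipartiteAbove_eq_sum_card_bipartiteBelow
    (s := 𝓑.filter (fun B => x ∈ B)) (t := Finset.univ.erase x) (fun B y => y ∈ B)
  have h2 : ∀ B ∈ 𝓑.filter (fun B => x ∈ B),
      (Finset.bipartiteAbove (fun B y => y ∈ B) (Finset.univ.erase x) B).card = k - 1 := by
    intro B hB
    rw [Finset.mem_filter] at hB
    have : Finset.bipartiteAbove (fun B y => y ∈ B) (Finset.univ.erase x) B = B.erase x := by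
      ext y; simp [Finset.bipartiteAbove]
    rw [this, Finset.card_erase_of_mem hB.2, hk B hB.1]
  have h3 : ∀ y ∈ Finset.univ.erase x,
      (Finset.bipartiteBelow (fun B y => y ∈ B) (𝓑.filter (fun B => x ∈ B)) y).card = 2 := by
    intro y hy
    have hxy : x ≠ y := (Finset.ne_of_mem_erase hy).symm
    rw [← hlam x y hxy, Finset.bipartiteBelow, Finset.filter_filter]
  rw [Finset.sum_congr rfl h2, Finset.sum_congr rfl h3] at h1
  simp only [Finset.sum_const, smul_eq_mul, hr x, Finset.card_erase_of_mem (Finset.mem_univ x),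
    Finset.card_univ] at h1
  rw [h1, mul_comm]

lemma design_bk {V : Type*} [Fintype V] [DecidableEq V] (𝓑 : Finset (Finset V)) (k r : ℕ)
    (hk : ∀ B ∈ 𝓑, B.card = k)
    (hr : ∀ x : V, (𝓑.filter (fun B => x ∈ B)).card = r) :
    𝓑.card * k = Fintype.card V * r := by
  have h1 := Finset.sum_card_bipartiteAbove_eq_sum_card_bipartiteBelow
    (s := 𝓑) (t := (Finset.univ : Finset V)) (fun B y => y ∈ B)
  have h2 : ∀ B ∈ 𝓑,
      (Finset.bipartiteAbove (fun B y => y ∈ B) (Finset.univ : Finset V) B).card = k := by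
    intro B hB
    have : Finset.bipartiteAbove (fun B y => y ∈ B) (Finset.univ : Finset V) B = B := by
      ext y; simp [Finset.bipartiteAbove]
    rw [this, hk B hB]
  have h3 : ∀ y ∈ (Finset.univ : Finset V),
      (Finset.bipartiteBelow (fun B y => y ∈ B) 𝓑 y).card = r := fun y _ => hr y
  rw [Finset.sum_congr rfl h2, Finset.sum_congr rfl h3] at h1
  simpa using h1

/-- The Fisher inequality for `lambda = 2`, by the variance argument. -/
lemma design_fisher {V : Type*} [Fintype V] [DecidableEq V] (𝓑 : Finset (Finset V)) (k r : ℕ)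
    (hk : ∀ B ∈ 𝓑, B.card = k)
    (hlam : ∀ x y : V, x ≠ y → (𝓑.filter (fun B => x ∈ B ∧ y ∈ B)).card = 2)
    (hr : ∀ x : V, (𝓑.filter (fun B => x ∈ B)).card = r)
    (hk2 : 2 < k) (hkv : k < Fintype.card V) (B₀ : Finset V) (hB₀ : B₀ ∈ 𝓑) :
    k ≤ r ∧ 2 < r := by
  have hne : Nonempty V := Fintype.card_pos_iff.1 (by omega)
  obtain ⟨x₀⟩ := hne
  have e1 := design_rk 𝓑 k r hk hlam hr x₀ (by omega)
  have e2 := design_bk 𝓑 k r hk hr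
  have hr2 : 2 < r := by
    by_contra h
    have : r * (k - 1) ≤ 2 * (k - 1) := Nat.mul_le_mul_right _ (by omega)
    omega
  refine ⟨?_, hr2⟩
  -- sums of intersection sizes
  have s1 : ∑ B ∈ 𝓑, (B ∩ B₀).card = k * r := by
    have h1 := Finset.sum_card_bipartiteAbove_eq_sum_card_bipartiteBelow
      (s := 𝓑) (t := B₀) (fun B y => y ∈ B)
    have h2 : ∀ B ∈ 𝓑, (Finset.bipartiteAbove (fun B y => y ∈ B) B₀ B).card = (B ∩ B₀).card := by
      intro B hB
      congr 1
      ext y; simp [Finset.bipartiteAbove, and_comm]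
    rw [Finset.sum_congr rfl h2] at h1
    rw [h1, Finset.sum_congr rfl (fun y _ => show
      (Finset.bipartiteBelow (fun B y => y ∈ B) 𝓑 y).card = r from hr y)]
    simp [hk B₀ hB₀]
  have s2 : ∑ B ∈ 𝓑, ((B ∩ B₀).offDiag).card = 2 * (k * k - k) := by
    have h1 := Finset.sum_card_bipartiteAbove_eq_sum_card_bipartiteBelow
      (s := 𝓑) (t := B₀.offDiag) (fun B y => y.1 ∈ B ∧ y.2 ∈ B)
    have h2 : ∀ B ∈ 𝓑, (Finset.bipartiteAbove (fun B (y : V × V) => y.1 ∈ B ∧ y.2 ∈ B)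
        B₀.offDiag B).card = ((B ∩ B₀).offDiag).card := by
      intro B hB
      congr 1
      ext y; simp [Finset.bipartiteAbove, Finset.mem_offDiag]; tauto
    rw [Finset.sum_congr rfl h2] at h1
    rw [h1, Finset.sum_congr rfl (fun y hy => show
      (Finset.bipartiteBelow (fun B (y : V × V) => y.1 ∈ B ∧ y.2 ∈ B) 𝓑 y).card = 2 from
        hlam y.1 y.2 (Finset.mem_offDiag.1 hy).2.2)]
    simp [hk B₀ hB₀, Finset.offDiag_card, mul_comm]
  -- pass to integers, and remove `B₀`
  set f : Finset V → ℤ := fun B => ((B ∩ B₀).card : ℤ) with hf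
  have t1 : ∑ B ∈ 𝓑, f B = k * r := by
    have := congrArg (Nat.cast : ℕ → ℤ) s1
    push_cast at this; exact this
  have t2 : ∑ B ∈ 𝓑, (f B * f B - f B) = 2 * (k * k - k) := by
    have := congrArg (Nat.cast : ℕ → ℤ) s2
    rw [Nat.cast_mul, Nat.cast_sub (by nlinarith)] at this
    push_cast at this; rw [← this]
    refine Finset.sum_congr rfl (fun B _ => ?_)
    rw [Finset.offDiag_card, Nat.cast_sub (by nlinarith [sq_nonneg ((B ∩ B₀).card)]) ]
    push_cast; rfl
  have hf0 : f B₀ = k := by simp [hf, hk B₀ hB₀]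
  have t3 : ∑ B ∈ 𝓑.erase B₀, f B = k * r - k := by
    rw [← t1, ← Finset.add_sum_erase _ _ hB₀, hf0]; ring
  have t4 : ∑ B ∈ 𝓑.erase B₀, f B ^ 2 = k * (k + r - 2) := by
    have h := Finset.add_sum_erase 𝓑 (fun B => f B * f B - f B) hB₀
    rw [t2] at h
    simp only [Finset.sum_sub_distrib, t3, hf0] at h
    have : ∑ B ∈ 𝓑.erase B₀, f B ^ 2 = ∑ B ∈ 𝓑.erase B₀, f B * f B :=
      Finset.sum_congr rfl (fun _ _ => by ring)
    rw [this]; linarith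
  have cs := sq_sum_le_card_mul_sum_sq (s := 𝓑.erase B₀) (f := f)
  have hb1 : 1 ≤ 𝓑.card := Finset.card_pos.2 ⟨_, hB₀⟩
  rw [t3, t4, Finset.card_erase_of_mem hB₀, Nat.cast_sub hb1] at cs
  have e1' : (r : ℤ) * (k - 1) = 2 * (Fintype.card V - 1) := by
    have := congrArg (Nat.cast : ℕ → ℤ) e1
    rw [Nat.cast_mul, Nat.cast_mul, Nat.cast_sub (by omega), Nat.cast_sub (by omega)] at this
    exact_mod_cast this
  have e2' : (𝓑.card : ℤ) * k = Fintype.card V * r := by exact_mod_cast e2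
  have hk2' : (2 : ℤ) < k := by exact_mod_cast hk2
  have hr2' : (2 : ℤ) < r := by exact_mod_cast hr2
  have key : 0 ≤ (k : ℤ) * (((k : ℤ) - 1) * ((r : ℤ) - k) * ((r : ℤ) - 2) ^ 2) := by
    have h5 : (k : ℤ) * (((k : ℤ) - 1) * ((r : ℤ) - k) * ((r : ℤ) - 2) ^ 2) =
      2 * (k * (((𝓑.card : ℤ) - 1) * (k * (k + r - 2)) - (k * r - k) ^ 2)) := by
      have : (k : ℤ) * (((𝓑.card : ℤ) - 1) * (k * (k + r - 2)) - (k * r - k) ^ 2)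
        = ((𝓑.card * k : ℤ) - k) * (k * (k + r - 2)) - k * (k * r - k) ^ 2 := by ring
      rw [this, e2']
      have hv : (2 : ℤ) * Fintype.card V = r * (k - 1) + 2 := by linarith
      linear_combination (-(r : ℤ) * (k * (k + r - 2))) * hv
    rw [h5]
    have : (0:ℤ) ≤ ((𝓑.card : ℤ) - 1) * (k * (k + r - 2)) - (k * r - k) ^ 2 := by
      push_cast at cs; linarith
    positivity
  by_contra hlt
  push Not at hlt
  have hlt' : (r : ℤ) < k := by exact_mod_cast hlt
  have : (0:ℤ) < (k : ℤ) * (((k : ℤ) - 1) * ((k : ℤ) - r) * ((r : ℤ) - 2) ^ 2) := by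
    have a1 : (0:ℤ) < (k:ℤ) - 1 := by linarith
    have a2 : (0:ℤ) < (k:ℤ) - r := by linarith
    have a3 : (0:ℤ) < (r:ℤ) - 2 := by linarith
    positivity
  nlinarith

/-- Orbit counting: every block through `0` meets an invariant set in the same number of points. -/
lemma design_orbit {V : Type*} [Fintype V] [DecidableEq V] [AddCommGroup V]
    (𝓑 : Finset (Finset V)) (r : ℕ) (G₀ : Subgroup (Equiv.Perm V))
    (hlam : ∀ x y : V, x ≠ y → (𝓑.filter (fun B => x ∈ B ∧ y ∈ B)).card = 2)
    (hr : ∀ x : V, (𝓑.filter (fun B => x ∈ B)).card = r)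
    (hadd : ∀ g ∈ G₀, g 0 = 0)
    (hflag : ∀ B ∈ 𝓑, ∀ C ∈ 𝓑, ∀ x ∈ B, ∀ y ∈ C,
      ∃ g ∈ G₀, ∃ v : V, B.image (fun z => g z + v) = C ∧ g x + v = y)
    (D : Finset V) (h0 : (0 : V) ∉ D) (hD : ∀ g ∈ G₀, ∀ x, g x ∈ D ↔ x ∈ D)
    (B₀ : Finset V) (hB₀ : B₀ ∈ 𝓑) (h0B : (0 : V) ∈ B₀) :
    r * (B₀ ∩ D).card = 2 * D.card := by
  have h1 := Finset.sum_card_bipartiteAbove_eq_sum_card_bipartiteBelow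
    (s := 𝓑.filter (fun B => (0 : V) ∈ B)) (t := D) (fun B y => y ∈ B)
  have h2 : ∀ B ∈ 𝓑.filter (fun B => (0 : V) ∈ B),
      (Finset.bipartiteAbove (fun B y => y ∈ B) D B).card = (B₀ ∩ D).card := by
    intro B hB
    rw [Finset.mem_filter] at hB
    obtain ⟨g, hg, v, hgB, hg0⟩ := hflag B₀ hB₀ B hB.1 0 h0B 0 hB.2
    rw [hadd g hg, zero_add] at hg0
    subst hg0
    have : Finset.bipartiteAbove (fun B y => y ∈ B) D B = (B₀ ∩ D).image g := by
      ext y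
      simp only [Finset.bipartiteAbove, Finset.mem_filter, Finset.mem_image, Finset.mem_inter]
      rw [← hgB]
      simp only [Finset.mem_image, add_zero]
      constructor
      · rintro ⟨hyD, z, hz, rfl⟩
        exact ⟨z, ⟨hz, (hD g hg z).1 hyD⟩, rfl⟩
      · rintro ⟨z, ⟨hz, hzD⟩, rfl⟩
        exact ⟨(hD g hg z).2 hzD, z, hz, rfl⟩
    rw [this, Finset.card_image_of_injective _ g.injective]
  have h3 : ∀ y ∈ D,
      (Finset.bipartiteBelow (fun B y => y ∈ B) (𝓑.filter (fun B => (0 : V) ∈ B)) y).card = 2 := by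
    intro y hy
    have hxy : (0 : V) ≠ y := fun h => h0 (h ▸ hy)
    rw [← hlam 0 y hxy, Finset.bipartiteBelow, Finset.filter_filter]
  rw [Finset.sum_congr rfl h2, Finset.sum_congr rfl h3] at h1
  simp only [Finset.sum_const, smul_eq_mul, hr 0] at h1
  rw [h1, mul_comm]

/-! ### Finite field facts -/

lemma exists_conj (K : Type*) [Field K] [Fintype K] (q₀ : ℕ) (hq : Fintype.card K = q₀ ^ 2) :
    2 ≤ q₀ ∧ ∃ φ : K →+* K, (∀ c, φ c = c ^ q₀) ∧ ∀ c, φ (φ c) = c := by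
  have h2 : 2 ≤ q₀ := by
    have := Fintype.one_lt_card (α := K)
    by_contra h
    have : q₀ ^ 2 ≤ 1 ^ 2 := Nat.pow_le_pow_left (by omega) 2
    omega
  refine ⟨h2, ?_⟩
  obtain ⟨p, hp⟩ := CharP.exists K
  obtain ⟨f, hpp, hf⟩ := FiniteField.card K p
  have := Fact.mk hpp
  have : q₀ ∣ p ^ (f : ℕ) := by rw [← hf, hq]; exact dvd_pow_self _ two_ne_zero
  obtain ⟨e, -, rfl⟩ := (Nat.dvd_prime_pow hpp).1 this
  refine ⟨iterateFrobenius K p e, fun c => iterateFrobenius_def p e c, fun c => ?_⟩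
  rw [iterateFrobenius_def, iterateFrobenius_def, ← pow_mul, ← sq, ← hq]
  exact FiniteField.pow_card c

section field
variable {K : Type*} [Field K] [Fintype K] [DecidableEq K] {q₀ : ℕ} {φ : K →+* K}

lemma card_fix_neg_le (h2 : 2 ≤ q₀) (hφ : ∀ c, φ c = c ^ q₀) (ε : K) :
    (Finset.univ.filter (fun c : K => φ c = ε * c)).card ≤ q₀ := by
  classical
  open Polynomial in
  have hdeg : (X ^ q₀ - C ε * X : K[X]).natDegree = q₀ := by
    compute_degree!
    · simp [show q₀ ≠ 1 by omega]
    · omega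
    · omega
  open Polynomial in
  have hne : (X ^ q₀ - C ε * X : K[X]) ≠ 0 := by
    intro h; rw [h] at hdeg; simp at hdeg; omega
  open Polynomial in
  have hsub : (Finset.univ.filter (fun c : K => φ c = ε * c)) ⊆
      (X ^ q₀ - C ε * X : K[X]).roots.toFinset := by
    intro c hc
    rw [Finset.mem_filter] at hc
    rw [Multiset.mem_toFinset, mem_roots hne]
    simp [IsRoot, ← hφ, hc.2]
  refine (Finset.card_le_card hsub).trans ((Multiset.toFinset_card_le _).trans ?_)
  exact (Polynomial.card_roots' _).trans hdeg.le

/-- the trace map -/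
def trHom (φ : K →+* K) : K →+ K where
  toFun c := c + φ c
  map_zero' := by simp
  map_add' a b := by rw [map_add]; ring

lemma field_trace (hq : Fintype.card K = q₀ ^ 2) (h2 : 2 ≤ q₀) (hφ : ∀ c, φ c = c ^ q₀)
    (hinv : ∀ c, φ (φ c) = c) :
    (Finset.univ.filter (fun c : K => φ c = c)).card = q₀ ∧
    (∀ d, φ d = d → ∃ b, b + φ b = d) ∧ (∃ l : K, l ≠ 0 ∧ φ l = -l) := by
  classical
  have hF := card_fix_neg_le h2 hφ (1 : K)
  have hN := card_fix_neg_le h2 hφ (-1 : K)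
  simp only [one_mul, neg_mul] at hF hN
  have hker : Nat.card (trHom φ).ker = (Finset.univ.filter (fun c : K => φ c = -c)).card := by
    rw [Nat.card_eq_fintype_card, ← Fintype.card_coe]
    refine Fintype.card_congr (Equiv.subtypeEquivRight fun c => ?_)
    simp only [AddMonoidHom.mem_ker, Finset.mem_filter, Finset.mem_univ, true_and]
    show c + φ c = 0 ↔ _
    rw [add_comm, add_eq_zero_iff_eq_neg]
  have hsub : Finset.univ.image (trHom φ) ⊆ Finset.univ.filter (fun c : K => φ c = c) := by
    intro c hc
    obtain ⟨b, -, rfl⟩ := Finset.mem_image.1 hc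
    simp only [Finset.mem_filter, Finset.mem_univ, true_and]
    show φ (b + φ b) = b + φ b
    rw [map_add, hinv, add_comm]
  have hrange : Nat.card (trHom φ).range = (Finset.univ.image (trHom φ)).card := by
    rw [Nat.card_eq_fintype_card, ← Fintype.card_coe]
    refine Fintype.card_congr (Equiv.subtypeEquivRight fun c => ?_)
    simp
  have hmul : Nat.card (trHom φ).range * Nat.card (trHom φ).ker = q₀ ^ 2 := by
    rw [← hq, ← Nat.card_eq_fintype_card, ← AddSubgroup.index_ker, mul_comm]
    exact AddSubgroup.card_mul_index _
  have hle := Finset.card_le_card hsub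
  rw [hrange, hker] at hmul
  set a := (Finset.univ.image (trHom φ)).card
  set b := (Finset.univ.filter (fun c : K => φ c = -c)).card
  have ha : a = q₀ := by
    by_contra h
    have : a < q₀ := by omega
    nlinarith
  have hb : b = q₀ := by
    rw [ha] at hmul; nlinarith
  have hfix : (Finset.univ.filter (fun c : K => φ c = c)).card = q₀ := by omega
  refine ⟨hfix, ?_, ?_⟩
  · intro d hd
    have heq := Finset.eq_of_subset_of_card_le hsub (by rw [hfix]; exact ha.ge)
    have : d ∈ Finset.univ.image (trHom φ) := by rw [heq]; simpa using hd
    obtain ⟨b, -, hb⟩ := Finset.mem_image.1 this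
    exact ⟨b, hb⟩
  · have : 1 < b := by omega
    obtain ⟨l, hl, hl0⟩ := Finset.exists_mem_ne this 0
    exact ⟨l, hl0, (Finset.mem_filter.1 hl).2⟩

lemma field_norm (hq : Fintype.card K = q₀ ^ 2) (h2 : 2 ≤ q₀) (hφ : ∀ c, φ c = c ^ q₀)
    (d : K) (hd0 : d ≠ 0) (hd : φ d = d) : ∃ b, b ≠ 0 ∧ b * φ b = d := by
  obtain ⟨g, hg⟩ := IsCyclic.exists_generator (α := Kˣ)
  obtain ⟨i, hi⟩ := Subgroup.mem_zpowers_iff.1 (hg (Units.mk0 d hd0))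
  obtain ⟨s, rfl⟩ : ∃ s, q₀ = s + 1 := ⟨q₀ - 1, by omega⟩
  have hord : orderOf g = s * (s + 2) := by
    rw [orderOf_eq_card_of_forall_mem_zpowers hg, Nat.card_eq_fintype_card, Fintype.card_units, hq]
    have : (s + 1) ^ 2 = s * (s + 2) + 1 := by ring
    omega
  have h1 : (Units.mk0 d hd0) ^ s = 1 := by
    ext
    rw [Units.val_pow_eq_pow_val, Units.val_mk0, Units.val_one]
    rw [hφ, pow_succ] at hd
    exact mul_right_cancel₀ hd0 (by rw [hd, one_mul])
  rw [← hi, ← zpow_natCast, ← _root_.zpow_mul, ← orderOf_dvd_iff_zpow_eq_one, hord, mul_comm i] at h1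
  push_cast at h1
  have hs : (s : ℤ) ≠ 0 := by omega
  obtain ⟨j, rfl⟩ := Int.dvd_of_mul_dvd_mul_left hs h1
  refine ⟨((g ^ j : Kˣ) : K), Units.ne_zero _, ?_⟩
  rw [hφ, ← pow_succ', ← Units.val_pow_eq_pow_val, ← zpow_natCast, ← _root_.zpow_mul]
  have := congrArg Units.val hi
  rw [Units.val_mk0] at this
  rw [← this]
  congr 2
  push_cast; ring

end field

/-! ### Hermitian forms -/

/-- A nondegenerate Hermitian form. -/
structure Herm {K V : Type*} [Field K] [AddCommGroup V] [Module K V] (φ : K →+* K)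
    (h : V → V → K) : Prop where
  inv : ∀ c, φ (φ c) = c
  addr : ∀ x y z, h x (y + z) = h x y + h x z
  smulr : ∀ c x y, h x (c • y) = c * h x y
  symm : ∀ x y, h y x = φ (h x y)
  nd : ∀ x, x ≠ 0 → ∃ y, h x y ≠ 0

/-- The Eichler-type transformations. -/
def eich {K V : Type*} [Field K] [AddCommGroup V] [Module K V]
    (h : V → V → K) (x z : V) (β : K) (u : V) : V :=
  u + h x u • z - (h z u + β * h x u) • x

section herm
variable {K V : Type*} [Field K] [AddCommGroup V] [Module K V] {φ : K →+* K} {h : V → V → K}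

lemma Herm.addl (H : Herm φ h) (x y z : V) : h (x + y) z = h x z + h y z := by
  rw [H.symm z, H.addr, map_add, ← H.symm, ← H.symm]

lemma Herm.smull (H : Herm φ h) (c : K) (x y : V) : h (c • x) y = φ c * h x y := by
  rw [H.symm y, H.smulr, map_mul, ← H.symm]

lemma Herm.zeror (H : Herm φ h) (x : V) : h x 0 = 0 := by
  have := H.smulr 0 x 0; simpa using this

lemma Herm.zerol (H : Herm φ h) (x : V) : h 0 x = 0 := by
  rw [H.symm x, H.zeror, map_zero]

lemma Herm.negr (H : Herm φ h) (x y : V) : h x (-y) = -h x y := by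
  have := H.smulr (-1) x y; simpa using this

lemma Herm.negl (H : Herm φ h) (x y : V) : h (-x) y = -h x y := by
  have := H.smull (-1) x y; simpa using this

lemma Herm.subr (H : Herm φ h) (x y z : V) : h x (y - z) = h x y - h x z := by
  rw [sub_eq_add_neg, H.addr, H.negr, sub_eq_add_neg]

lemma Herm.subl (H : Herm φ h) (x y z : V) : h (x - y) z = h x z - h y z := by
  rw [sub_eq_add_neg, H.addl, H.negl, sub_eq_add_neg]

lemma Herm.self (H : Herm φ h) (x : V) : φ (h x x) = h x x := (H.symm x x).symm

lemma Herm.symm0 (H : Herm φ h) {x y : V} (h0 : h x y = 0) : h y x = 0 := by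
  rw [H.symm x, h0, map_zero]

lemma Herm.symm_ne (H : Herm φ h) {x y : V} (h0 : h x y ≠ 0) : h y x ≠ 0 :=
  fun h1 => h0 (H.symm0 h1)

lemma eich_pres (H : Herm φ h) {x z : V} {β : K} (hx : h x x = 0) (hxz : h x z = 0)
    (hβ : β + φ β = h z z) (u v : V) : h (eich h x z β u) (eich h x z β v) = h u v := by
  have hzx := H.symm0 hxz
  simp only [eich, H.addl, H.addr, H.subl, H.subr, H.smull, H.smulr, hx, hxz, hzx, map_add,
    map_mul, ← H.symm]
  rw [← hβ]
  ring

lemma eich_self (h : V → V → K) {x z : V} {β : K} (hx : h x x = 0) (hzx : h z x = 0) :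
    eich h x z β x = x := by simp [eich, hx, hzx]

lemma eich_trans (H : Herm φ h) {x y y' : V} (hx : h x x = 0) (hc : h x y ≠ 0)
    (hc' : h x y' = h x y) (hd : h y' y' = h y y) :
    ∃ z β, h x z = 0 ∧ β + φ β = h z z ∧ eich h x z β y = y' := by
  obtain ⟨c, hcc⟩ : ∃ c, c = h x y := ⟨_, rfl⟩
  rw [← hcc] at hc hc'
  have hφc : φ c ≠ 0 := by simpa using hc
  obtain ⟨z, hz⟩ : ∃ z, z = c⁻¹ • (y' - y) := ⟨_, rfl⟩
  have hy' : y' = y + c • z := by rw [hz, smul_smul, mul_inv_cancel₀ hc, one_smul]; abel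
  have hxz : h x z = 0 := by rw [hz, H.smulr, H.subr, hc', ← hcc]; ring
  refine ⟨z, -h z y * c⁻¹, hxz, ?_, ?_⟩
  · have h1 : h (y + c • z) (y + c • z) = h y y := by rw [← hy', hd]
    simp only [H.addl, H.addr, H.smull, H.smulr] at h1
    have h2 : h y z = φ (h z y) := H.symm z y
    simp only [map_mul, map_neg, map_inv₀, ← h2]
    field_simp
    rw [mul_comm c (φ c)]
    linear_combination -h1
  · rw [eich, ← hcc, hy']
    have : h z y + -h z y * c⁻¹ * c = 0 := by field_simp; ring
    rw [this]; simp

end herm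

/-! ### Counting -/

lemma fib_const {V K : Type*} [DecidableEq K] (S : Finset V) (T : Finset K) (f : V → K)
    (hmap : ∀ x ∈ S, f x ∈ T)
    (hle : ∀ d ∈ T, ∀ e ∈ T, (S.filter (fun x => f x = d)).card ≤ (S.filter (fun x => f x = e)).card)
    (d : K) (hd : d ∈ T) : T.card * (S.filter (fun x => f x = d)).card = S.card := by
  rw [Finset.card_eq_sum_card_fiberwise hmap,
    Finset.sum_congr rfl (fun e he => le_antisymm (hle e he d hd) (hle d hd e he))]
  simp

lemma scal_dvd {K V : Type*} [Field K] [Fintype K] [DecidableEq K] [AddCommGroup V] [Module K V]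
    [DecidableEq V] (S : Finset V) (h0 : (0 : V) ∉ S) (hS : ∀ c : K, c ≠ 0 → ∀ x ∈ S, c • x ∈ S) :
    (Fintype.card K - 1) ∣ S.card := by
  classical
  rw [Finset.card_eq_sum_card_image (fun x => Submodule.span K {x}) S]
  refine Finset.dvd_sum (fun W hW => ?_)
  obtain ⟨x, hx, rfl⟩ := Finset.mem_image.1 hW
  have hx0 : x ≠ 0 := fun h => h0 (h ▸ hx)
  have : S.filter (fun y => Submodule.span K {y} = Submodule.span K {x}) =
      (Finset.univ.erase (0 : K)).image (fun c => c • x) := by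
    ext y
    simp only [Finset.mem_filter, Finset.mem_image, Finset.mem_erase, Finset.mem_univ, and_true]
    constructor
    · rintro ⟨hy, hyx⟩
      have : y ∈ Submodule.span K {x} := hyx ▸ Submodule.mem_span_singleton_self y
      obtain ⟨c, rfl⟩ := Submodule.mem_span_singleton.1 this
      refine ⟨c, ?_, rfl⟩
      rintro rfl
      exact h0 (by simpa using hy)
    · rintro ⟨c, hc, rfl⟩
      exact ⟨hS c hc x hx, Submodule.span_singleton_smul_eq (IsUnit.mk0 c hc) x⟩
  rw [this, Finset.card_image_of_injective _ (smul_left_injective K hx0),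
    Finset.card_erase_of_mem (Finset.mem_univ _), Finset.card_univ]

section count
variable {K V : Type*} [Field K] [Fintype K] [DecidableEq K] [AddCommGroup V] [Module K V]
  [Fintype V] [DecidableEq V] {q₀ : ℕ} {φ : K →+* K} {h : V → V → K}

lemma exists_tr (H : Herm φ h) (hT : ∀ d, φ d = d → ∃ b, b + φ b = d) {c d : K} (hc : c ≠ 0)
    (hd : φ d = d) : ∃ a, a * c + φ (a * c) = d := by
  obtain ⟨b, hb⟩ := hT d hd
  exact ⟨b * c⁻¹, by rw [mul_assoc, inv_mul_cancel₀ hc, mul_one, hb]⟩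

lemma card_tr (H : Herm φ h) (hF : (Finset.univ.filter (fun c : K => φ c = c)).card = q₀)
    (hT : ∀ d, φ d = d → ∃ b, b + φ b = d) (w : V) (hw : w ≠ 0) (d : K) (hd : φ d = d) :
    q₀ * (Finset.univ.filter (fun y : V => h w y + φ (h w y) = d)).card = Fintype.card V := by
  obtain ⟨u, hu⟩ := H.nd w hw
  rw [← hF, ← Finset.card_univ]
  refine fib_const Finset.univ (Finset.univ.filter (fun c : K => φ c = c))
    (fun y => h w y + φ (h w y)) ?_ ?_ d (by simpa using hd)
  · intro y _
    simp only [Finset.mem_filter, Finset.mem_univ, true_and, map_add, H.inv]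
    ring
  · intro d hd e he
    simp only [Finset.mem_filter, Finset.mem_univ, true_and] at hd he
    obtain ⟨a, ha⟩ := exists_tr H hT hu (d := e - d) (by rw [map_sub, hd, he])
    refine Finset.card_le_card_of_injOn (fun y => y + a • u) ?_ (fun x _ y _ hxy => by simpa using hxy)
    intro y hy
    simp only [Finset.coe_filter, Finset.mem_univ, true_and, Set.mem_ofPred_eq] at hy ⊢
    rw [H.addr, H.smulr, map_add]
    linear_combination hy + ha

lemma card_gamma (H : Herm φ h) (hF : (Finset.univ.filter (fun c : K => φ c = c)).card = q₀)
    (hT : ∀ d, φ d = d → ∃ b, b + φ b = d) (x : V) (hx0 : x ≠ 0) (hx : h x x = 0) (c : K)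
    (hc : c ≠ 0) :
    Fintype.card K * (q₀ * (Finset.univ.filter (fun y : V => h x y = c ∧ h y y = 0)).card)
      = Fintype.card V := by
  obtain ⟨u, hu⟩ := H.nd x hx0
  have h1 := fib_const (Finset.univ : Finset V) (Finset.univ : Finset K) (fun y => h x y)
    (fun _ _ => Finset.mem_univ _) (by
      intro d _ e _
      refine Finset.card_le_card_of_injOn (fun y => y + ((e - d) * (h x u)⁻¹) • u) ?_
        (fun x _ y _ hxy => by simpa using hxy)
      intro y hy
      simp only [Finset.coe_filter, Finset.mem_univ, true_and, Set.mem_ofPred_eq] at hy ⊢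
      rw [H.addr, H.smulr, hy, mul_assoc, inv_mul_cancel₀ hu]; ring) c (Finset.mem_univ _)
  have h2 := fib_const (Finset.univ.filter (fun y : V => h x y = c))
    (Finset.univ.filter (fun c : K => φ c = c)) (fun y => h y y)
    (fun y _ => by simpa using H.self y) (by
      intro d hd e he
      simp only [Finset.mem_filter, Finset.mem_univ, true_and] at hd he
      have hc' : φ c ≠ 0 := by simpa using hc
      obtain ⟨a, ha⟩ := exists_tr H hT hc' (d := e - d) (by rw [map_sub, hd, he])
      refine Finset.card_le_card_of_injOn (fun y => y + a • x) ?_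
        (fun x _ y _ hxy => by simpa using hxy)
      intro y hy
      simp only [Finset.coe_filter, Finset.mem_filter, Finset.mem_univ, true_and,
        Set.mem_ofPred_eq] at hy ⊢
      obtain ⟨hy1, hy2⟩ := hy
      have hyx : h y x = φ c := by rw [H.symm x, hy1]
      rw [map_mul, H.inv] at ha
      simp only [H.addr, H.addl, H.smulr, H.smull, hx, hy1, hy2, hyx]
      refine ⟨by ring, ?_⟩
      linear_combination ha) 0 (by simp)
  rw [Finset.filter_filter, hF] at h2
  rw [h2, ← Finset.card_univ, h1, Finset.card_univ]

lemma card_pairs (H : Herm φ h) (hF : (Finset.univ.filter (fun c : K => φ c = c)).card = q₀)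
    (hT : ∀ d, φ d = d → ∃ b, b + φ b = d) :
    q₀ * ∑ y : V, (Finset.univ.filter (fun z : V => h z z = h y y)).card =
      q₀ * Fintype.card V + (Fintype.card V - 1) * Fintype.card V := by
  have h1 : ∑ y : V, (Finset.univ.filter (fun z : V => h z z = h y y)).card =
      ∑ w : V, (Finset.univ.filter (fun y : V => h w y + φ (h w y) = - h w w)).card := by
    simp only [Finset.card_filter]
    rw [Finset.sum_comm (γ := V)]
    conv_rhs => rw [Finset.sum_comm]
    rw [Finset.sum_comm]
    refine Finset.sum_congr rfl (fun y _ => ?_)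
    rw [← Equiv.sum_comp (Equiv.addRight y)]
    refine Finset.sum_congr rfl (fun w _ => ?_)
    refine if_congr ?_ rfl rfl
    simp only [Equiv.coe_addRight, H.addr, H.addl]
    rw [H.symm w y]
    constructor
    · intro e; linear_combination e
    · intro e; linear_combination e
  rw [h1, Finset.mul_sum, ← Finset.add_sum_erase _ _ (Finset.mem_univ (0 : V)),
    Finset.sum_congr rfl (fun w hw => card_tr H hF hT w (Finset.ne_of_mem_erase hw) (- h w w)
      (by rw [map_neg, H.self]))]
  simp [H.zerol, Finset.card_erase_of_mem]

lemma card_iso (H : Herm φ h) (h2 : 2 ≤ q₀)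
    (hF : (Finset.univ.filter (fun c : K => φ c = c)).card = q₀)
    (hT : ∀ d, φ d = d → ∃ b, b + φ b = d)
    (hN : ∀ d : K, d ≠ 0 → φ d = d → ∃ b, b ≠ 0 ∧ b * φ b = d) :
    ∃ A : ℕ, (Finset.univ.filter (fun z : V => h z z = 0)).card + (q₀ - 1) * A = Fintype.card V ∧
      (((Finset.univ.filter (fun z : V => h z z = 0)).card : ℤ) - A) ^ 2 = Fintype.card V ∧
      (Finset.univ.filter (fun z : V => h z z ≠ 0)).card = (q₀ - 1) * A := by
  classical
  set F := (Finset.univ.filter (fun c : K => φ c = c)) with hFdef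
  let Fc : K → ℕ := fun d => (Finset.univ.filter (fun z : V => h z z = d)).card
  have hle : ∀ d ∈ F.erase 0, ∀ e ∈ F.erase 0, Fc d ≤ Fc e := by
    intro d hd e he
    simp only [hFdef, Finset.mem_filter, Finset.mem_univ, true_and, Finset.mem_erase] at hd he
    obtain ⟨b, hb0, hb⟩ := hN (e * d⁻¹) (mul_ne_zero he.1 (inv_ne_zero hd.1))
      (by rw [map_mul, map_inv₀, hd.2, he.2])
    refine Finset.card_le_card_of_injOn (fun y => b • y) ?_
      (fun x _ y _ hxy => smul_right_injective V hb0 hxy)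
    intro y hy
    simp only [Finset.coe_filter, Finset.mem_univ, true_and, Set.mem_ofPred_eq] at hy ⊢
    rw [H.smulr, H.smull, ← mul_assoc, hb, hy, mul_assoc, inv_mul_cancel₀ hd.1, mul_one]
  have h1F : (1 : K) ∈ F.erase 0 := by simp [hFdef]
  have h0F : (0 : K) ∈ F := by simp [hFdef]
  have hmap : ∀ y ∈ (Finset.univ : Finset V), h y y ∈ F := fun y _ => by
    simpa [hFdef] using H.self y
  have hcard : (F.erase 0).card = q₀ - 1 := by rw [Finset.card_erase_of_mem h0F, hF]
  have hA : ∀ d ∈ F.erase 0, Fc d = Fc 1 := fun d hd =>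
    le_antisymm (hle d hd 1 h1F) (hle 1 h1F d hd)
  have e1 : Fc 0 + (q₀ - 1) * Fc 1 = Fintype.card V := by
    rw [← Finset.card_univ, Finset.card_eq_sum_card_fiberwise hmap,
      ← Finset.add_sum_erase _ _ h0F, Finset.sum_congr rfl hA]
    simp [hcard, Fc]
  have e2 : ∑ y : V, Fc (h y y) = Fc 0 * Fc 0 + (q₀ - 1) * (Fc 1 * Fc 1) := by
    rw [← Finset.sum_fiberwise_of_maps_to hmap]
    have : ∀ d ∈ F, ∑ y ∈ Finset.univ.filter (fun z : V => h z z = d), Fc (h y y) =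
        Fc d * Fc d := by
      intro d _
      rw [Finset.sum_congr rfl (fun y hy => by rw [(Finset.mem_filter.1 hy).2])]
      simp [Fc]
    rw [Finset.sum_congr rfl this, ← Finset.add_sum_erase _ _ h0F,
      Finset.sum_congr rfl (fun d hd => by rw [hA d hd])]
    simp [hcard]
  have e3 := card_pairs H hF hT
  rw [show ∑ y : V, (Finset.univ.filter (fun z : V => h z z = h y y)).card
    = ∑ y : V, Fc (h y y) from rfl, e2] at e3
  refine ⟨Fc 1, e1, ?_, ?_⟩
  · have hV : 1 ≤ Fintype.card V := Fintype.card_pos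
    obtain ⟨s, rfl⟩ : ∃ s, q₀ = s + 1 := ⟨q₀ - 1, by omega⟩
    obtain ⟨t, ht⟩ : ∃ t, Fintype.card V = t + 1 := ⟨Fintype.card V - 1, by omega⟩
    change ((Fc 0 : ℤ) - Fc 1) ^ 2 = _
    rw [ht] at e1 e3 ⊢
    simp only [Nat.add_sub_cancel] at e1 e3
    have e1' : (Fc 0 : ℤ) + s * Fc 1 = t + 1 := by exact_mod_cast e1
    have e3' : ((s : ℤ) + 1) * (Fc 0 * Fc 0 + s * (Fc 1 * Fc 1)) = (s + 1) * (t + 1) + t * (t + 1) :=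
      by exact_mod_cast e3
    have hs : (s : ℤ) ≠ 0 := by omega
    apply mul_left_cancel₀ hs
    push_cast
    linear_combination e3' - (Fc 0 + s * Fc 1 + t + 1) * e1'
  · have := Finset.card_filter_add_card_filter_not (s := (Finset.univ : Finset V))
      (fun z : V => h z z = 0)
    rw [Finset.card_univ, ← e1] at this
    exact Nat.add_left_cancel this

end count

/-! ### Geometry -/

section geom
variable {K V : Type*} [Field K] [Fintype K] [DecidableEq K] [AddCommGroup V] [Module K V]
  [Fintype V] [DecidableEq V] {φ : K →+* K} {h : V → V → K}

lemma exists_perp_val (H : Herm φ h) (hT : ∀ d, φ d = d → ∃ b, b + φ b = d)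
    (hN : ∀ d : K, d ≠ 0 → φ d = d → ∃ b, b ≠ 0 ∧ b * φ b = d)
    (hdim : ∀ a b : V, ∃ v, v ∉ Submodule.span K {a, b}) {w u : V} (hw : h w w ≠ 0)
    (hu : h u u ≠ 0) (hwu : h w u = 0) :
    ∃ z, h w z = 0 ∧ h u z = 0 ∧ h z z = - h u u := by
  have huw := H.symm0 hwu
  obtain ⟨v0, hv0⟩ := hdim w u
  have hproj : ∀ y : V, ∃ a b : K, h w (y - a • w - b • u) = 0 ∧ h u (y - a • w - b • u) = 0 := by
    intro y
    refine ⟨h w y / h w w, h u y / h u u, ?_, ?_⟩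
    · simp only [H.subr, H.smulr, hwu]; field_simp; ring
    · simp only [H.subr, H.smulr, huw]; field_simp; ring
  obtain ⟨a, b, hv1, hv2⟩ := hproj v0
  obtain ⟨v, hv⟩ : ∃ v, v = v0 - a • w - b • u := ⟨_, rfl⟩
  rw [← hv] at hv1 hv2
  have hvne : v ≠ 0 := by
    rintro rfl
    apply hv0
    have : v0 = a • w + b • u := by
      have := hv.symm
      rw [sub_sub, sub_eq_zero] at this
      exact this
    rw [this]
    exact Submodule.mem_span_pair.2 ⟨a, b, rfl⟩
  by_cases hvv : h v v = 0
  · obtain ⟨y, hy⟩ := H.nd v hvne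
    obtain ⟨a, b, hy1, hy2⟩ := hproj y
    obtain ⟨y', hy'⟩ : ∃ y', y' = y - a • w - b • u := ⟨_, rfl⟩
    rw [← hy'] at hy1 hy2
    have hvy' : h v y' ≠ 0 := by
      rw [hy', H.subr, H.subr, H.smulr, H.smulr, H.symm0 hv1, H.symm0 hv2]
      simpa using hy
    obtain ⟨c, hc⟩ := exists_tr H hT (H.symm_ne hvy') (d := - h u u - h y' y')
      (by rw [map_sub, map_neg, H.self, H.self])
    refine ⟨y' + c • v, ?_, ?_, ?_⟩
    · rw [H.addr, H.smulr, hy1, hv1]; ring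
    · rw [H.addr, H.smulr, hy2, hv2]; ring
    · simp only [H.addr, H.addl, H.smulr, H.smull, hvv]
      rw [map_mul, ← H.symm] at hc
      linear_combination hc
  · obtain ⟨b, -, hb⟩ := hN (- h u u / h v v) (div_ne_zero (neg_ne_zero.2 hu) hvv)
      (by rw [map_div₀, map_neg, H.self, H.self])
    refine ⟨b • v, ?_, ?_, ?_⟩
    · rw [H.smulr, hv1, mul_zero]
    · rw [H.smulr, hv2, mul_zero]
    · rw [H.smulr, H.smull, ← mul_assoc, hb]; field_simp

lemma exists_e (H : Herm φ h) (hT : ∀ d, φ d = d → ∃ b, b + φ b = d)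
    (hN : ∀ d : K, d ≠ 0 → φ d = d → ∃ b, b ≠ 0 ∧ b * φ b = d)
    (hdim : ∀ a b : V, ∃ v, v ∉ Submodule.span K {a, b}) {w x : V} (hw : h w w ≠ 0)
    (hx : h x x = 0) (hx0 : x ≠ 0) :
    ∃ e u : V, h e e = 0 ∧ h w e = 0 ∧ h e x ≠ 0 ∧ h w u = 0 ∧ h e u = h e x ∧ h u x = h u u := by
  obtain ⟨t, ht⟩ : ∃ t, t = h w x / h w w := ⟨_, rfl⟩
  obtain ⟨u, hu⟩ : ∃ u, u = x - t • w := ⟨_, rfl⟩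
  have hwu : h w u = 0 := by rw [hu, H.subr, H.smulr, ht]; field_simp; ring
  have hxu : x = u + t • w := by rw [hu]; abel
  have hu0 : u ≠ 0 := by
    rintro rfl
    rw [zero_add] at hxu
    rw [hxu, H.smulr, H.smull] at hx
    have : t = 0 := by simpa [hw] using hx
    exact hx0 (by rw [hxu, this, zero_smul])
  have key : ∀ e, h w e = 0 → h e x = h e u := by
    intro e he
    rw [hxu, H.addr, H.smulr, H.symm0 he]; ring
  suffices hs : ∃ e, h e e = 0 ∧ h w e = 0 ∧ h e u ≠ 0 by
    obtain ⟨e, h1, h2, h3⟩ := hs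
    exact ⟨e, u, h1, h2, by rwa [key e h2], hwu, (key e h2).symm, key u hwu⟩
  by_cases huu : h u u = 0
  · obtain ⟨v0, hv0⟩ := H.nd u hu0
    obtain ⟨v, hv⟩ : ∃ v, v = v0 - (h w v0 / h w w) • w := ⟨_, rfl⟩
    have hwv : h w v = 0 := by rw [hv, H.subr, H.smulr]; field_simp; ring
    have huv : h u v ≠ 0 := by rw [hv, H.subr, H.smulr, H.symm0 hwu]; simpa using hv0
    have hvu := H.symm_ne huv
    obtain ⟨b, hb⟩ := exists_tr H hT hvu (d := - h v v) (by rw [map_neg, H.self])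
    refine ⟨v + b • u, ?_, ?_, ?_⟩
    · simp only [H.addr, H.addl, H.smulr, H.smull, huu]
      rw [map_mul, ← H.symm] at hb
      linear_combination hb
    · rw [H.addr, H.smulr, hwv, hwu]; ring
    · rw [H.addl, H.smull, huu]; simpa using hvu
  · obtain ⟨z, h1, h2, h3⟩ := exists_perp_val H hT hN hdim hw huu hwu
    refine ⟨u + z, ?_, ?_, ?_⟩
    · simp only [H.addr, H.addl, h2, H.symm0 h2, h3]; ring
    · rw [H.addr, hwu, h1, add_zero]
    · rw [H.addl, H.symm0 h2, add_zero]; exact huu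

/-- Three pairwise non-orthogonal vectors in the orbit of `x` under the stabiliser of `w`. -/
lemma exists_three (H : Herm φ h) (hT : ∀ d, φ d = d → ∃ b, b + φ b = d)
    (hN : ∀ d : K, d ≠ 0 → φ d = d → ∃ b, b ≠ 0 ∧ b * φ b = d)
    (hl : ∃ l : K, l ≠ 0 ∧ φ l = -l)
    (hdim : ∀ a b : V, ∃ v, v ∉ Submodule.span K {a, b}) {w x : V} (hw : h w w ≠ 0)
    (hx : h x x = 0) (hx0 : x ≠ 0) :
    ∃ (e e' : V) (l l' : K), h e e = 0 ∧ h e' e' = 0 ∧ l + φ l = 0 ∧ l' + φ l' = 0 ∧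
      eich h e 0 l w = w ∧ eich h e' 0 l' w = w ∧
      h x (eich h e 0 l x) ≠ 0 ∧ h x (eich h e' 0 l' x) ≠ 0 ∧
      h (eich h e 0 l x) (eich h e' 0 l' x) ≠ 0 := by
  obtain ⟨e, u, hee, hwe, hex, hwu, heu, hux⟩ := exists_e H hT hN hdim hw hx hx0
  obtain ⟨l, hl0, hl⟩ := hl
  have hue : h u e = φ (h e x) := by rw [← heu, ← H.symm]
  have hφ : φ (h e x) ≠ 0 := by simpa using hex
  obtain ⟨β, hβ0, hβ⟩ : ∃ β, β ≠ 0 ∧ β + φ β = - h u u := by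
    obtain ⟨β, hβ⟩ := hT (- h u u) (by rw [map_neg, H.self])
    by_cases hb : β = 0
    · refine ⟨l, hl0, ?_⟩
      rw [← hβ, hb, hl]; simp
    · exact ⟨β, hb, hβ⟩
  obtain ⟨b, hb⟩ : ∃ b, b = β / φ (h e x) := ⟨_, rfl⟩
  have hbβ : b * φ (h e x) = β := by rw [hb]; field_simp
  have hbβ' : φ b * h e x = φ β := by rw [← hbβ, map_mul, H.inv]
  obtain ⟨e', he'⟩ : ∃ e', e' = u + b • e := ⟨_, rfl⟩
  have hee' : h e' e' = 0 := by
    rw [he']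
    simp only [H.addr, H.addl, H.smulr, H.smull, hee, heu, hue]
    linear_combination hβ + hbβ + hbβ'
  have hex' : h e' x = -β := by
    rw [he', H.addl, H.smull, hux, hbβ']; linear_combination hβ
  have hwe' : h w e' = 0 := by rw [he', H.addr, H.smulr, hwu, hwe]; ring
  have hcross : h e e' = h e x := by rw [he', H.addr, H.smulr, hee, heu]; ring
  obtain ⟨n1, hn1⟩ : ∃ n1, n1 = h e x * φ (h e x) := ⟨_, rfl⟩
  obtain ⟨n2, hn2⟩ : ∃ n2, n2 = β * φ β := ⟨_, rfl⟩
  have hφβ : φ β ≠ 0 := by simpa using hβ0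
  have hn10 : n1 ≠ 0 := by rw [hn1]; exact mul_ne_zero hex hφ
  have hn20 : n2 ≠ 0 := by rw [hn2]; exact mul_ne_zero hβ0 hφβ
  have hfn1 : φ n1 = n1 := by rw [hn1, map_mul, H.inv, mul_comm]
  have hfn2 : φ n2 = n2 := by rw [hn2, map_mul, H.inv, mul_comm]
  have hxe : h x e = φ (h e x) := H.symm e x
  have hxe' : h x e' = -φ β := by rw [H.symm e' x, hex', map_neg]
  obtain ⟨l', hl'⟩ : ∃ l', l' = l * n1 / n2 := ⟨_, rfl⟩
  have hl'n : l' * n2 = l * n1 := by rw [hl']; field_simp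
  have hl'0 : l' ≠ 0 := by rw [hl']; exact div_ne_zero (mul_ne_zero hl0 hn10) hn20
  refine ⟨e, e', l, l', hee, hee', by rw [hl]; ring, ?_, ?_, ?_, ?_, ?_, ?_⟩
  · rw [hl', map_div₀, map_mul, hl, hfn1, hfn2]; ring
  · simp [eich, H.zerol, H.symm0 hwe]
  · simp [eich, H.zerol, H.symm0 hwe']
  · have : h x (eich h e 0 l x) = -(l * n1) := by
      simp only [eich, H.subr, H.addr, H.smulr, H.zerol, H.zeror, hx, hxe, hn1]; ring
    rw [this]; exact neg_ne_zero.2 (mul_ne_zero hl0 hn10)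
  · have : h x (eich h e' 0 l' x) = -(l' * n2) := by
      simp only [eich, H.subr, H.addr, H.smulr, H.zerol, H.zeror, hx, hxe', hex', hn2]; ring
    rw [this]; exact neg_ne_zero.2 (mul_ne_zero hl'0 hn20)
  · have : h (eich h e 0 l x) (eich h e' 0 l' x) = l * φ (h e x) * l' * β * h e x := by
      simp only [eich, H.subr, H.addr, H.smulr, H.subl, H.addl, H.smull, H.zerol, H.zeror, hx, hxe,
        hxe', hex', hcross, map_add, map_mul, map_zero, hl]
      rw [hn1, hn2] at hl'n
      linear_combination -hl'n
    rw [this]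
    exact mul_ne_zero (mul_ne_zero (mul_ne_zero (mul_ne_zero hl0 hφ) hl'0) hβ0) hex

end geom

/-! ### Matrices -/

section mat
variable {K : Type*} [Field K] {n : ℕ} {q₀ : ℕ} {φ : K →+* K}

/-- The form attached to a matrix. -/
def mform (φ : K →+* K) (J : Matrix (Fin n) (Fin n) K) (x y : Fin n → K) : K :=
  (fun i => φ (x i)) ⬝ᵥ (J *ᵥ y)

lemma mform_herm (J : Matrix (Fin n) (Fin n) K) (hinv : ∀ c, φ (φ c) = c) (hJ : IsUnit J.det)
    (hJs : (J.map φ)ᵀ = J) : Herm φ (mform φ J) where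
  inv := hinv
  addr x y z := by simp [mform, mulVec_add, dotProduct_add]
  smulr c x y := by simp [mform, mulVec_smul, dotProduct_smul]
  symm x y := by
    have hJ' : ∀ i j, φ (J i j) = J j i := fun i j => by
      conv_rhs => rw [← hJs]
      rfl
    simp only [mform, dotProduct, mulVec, map_sum, map_mul, hinv, Finset.mul_sum, hJ']
    rw [Finset.sum_comm]
    refine Finset.sum_congr rfl fun i _ => Finset.sum_congr rfl fun j _ => by ring
  nd x hx := by
    by_contra hc
    push Not at hc
    apply hx
    have h1 : (fun i => φ (x i)) ᵥ* J = 0 := by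
      apply dotProduct_eq
      intro y
      rw [← dotProduct_mulVec, zero_dotProduct]
      exact hc y
    have h2 : (fun i => φ (x i)) = 0 := by
      have := congrArg (fun v => v ᵥ* J⁻¹) h1
      simpa [vecMul_vecMul, Matrix.mul_nonsing_inv J hJ] using this
    funext i
    have := congrFun h2 i
    simpa using this

lemma mform_pres (J M : Matrix (Fin n) (Fin n) K) :
    (M.map φ)ᵀ * J * M = J ↔ ∀ x y, mform φ J (M *ᵥ x) (M *ᵥ y) = mform φ J x y := by
  have h1 : ∀ x y, mform φ J (M *ᵥ x) (M *ᵥ y) = mform φ ((M.map φ)ᵀ * J * M) x y := by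
    intro x y
    have : (fun i => φ ((M *ᵥ x) i)) = (fun i => φ (x i)) ᵥ* (M.map φ)ᵀ := by
      funext i
      rw [vecMul_transpose]
      exact RingHom.map_mulVec φ M x i
    rw [mform, mform, this, ← dotProduct_mulVec, mulVec_mulVec, mulVec_mulVec, Matrix.mul_assoc]
  constructor
  · intro h x y; rw [h1, h]
  · intro h
    ext i j
    have := h (Pi.single i 1) (Pi.single j 1)
    rw [h1] at this
    have e : (fun k => φ ((Pi.single i 1 : Fin n → K) k)) = Pi.single i 1 := by
      funext k
      by_cases hk : k = i
      · subst hk; simp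
      · simp [hk]
    simpa [mform, e] using this

lemma eich_matrix (J : Matrix (Fin n) (Fin n) K) (H : Herm φ (mform φ J)) (x z : Fin n → K) (β : K)
    (hx : mform φ J x x = 0) (hxz : mform φ J x z = 0) :
    ∃ M : Matrix (Fin n) (Fin n) K, M.det = 1 ∧ ∀ u, M *ᵥ u = eich (mform φ J) x z β u := by
  have hzx := H.symm0 hxz
  let A : Matrix (Fin n) (Fin 2) K := Matrix.of fun i j => ![z i - β * x i, x i] j
  let Bm : Matrix (Fin 2) (Fin n) K :=
    Matrix.of ![(fun i => φ (x i)) ᵥ* J, -((fun i => φ (z i)) ᵥ* J)]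
  have hB0 : ∀ u, (Bm *ᵥ u) 0 = mform φ J x u := fun u => by
    simp [Bm, mulVec, mform, dotProduct_mulVec]
  have hB1 : ∀ u, (Bm *ᵥ u) 1 = - mform φ J z u := fun u => by
    show (-((fun i => φ (z i)) ᵥ* J)) ⬝ᵥ u = _
    rw [neg_dotProduct, mform, dotProduct_mulVec]
  refine ⟨1 + A * Bm, ?_, ?_⟩
  · rw [Matrix.det_one_add_mul_comm, Matrix.det_fin_two]
    have c0 : ∀ i, (Bm * A) i 0 = (Bm *ᵥ (z - β • x)) i := fun i => by
      simp [Matrix.mul_apply, mulVec, dotProduct, A]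
    have c1 : ∀ i, (Bm * A) i 1 = (Bm *ᵥ x) i := fun i => by
      simp [Matrix.mul_apply, mulVec, dotProduct, A]
    simp only [Matrix.add_apply, c0, c1, hB0, hB1, H.subr, H.smulr, hx, hxz, hzx]
    simp
  · intro u
    rw [Matrix.add_mulVec, one_mulVec, ← mulVec_mulVec]
    funext i
    have : (A *ᵥ (Bm *ᵥ u)) i = (z i - β * x i) * mform φ J x u - x i * mform φ J z u := by
      conv_lhs => rw [mulVec, dotProduct, Fin.sum_univ_two, hB0, hB1]
      simp [A]; ring
    rw [Pi.add_apply, this]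
    simp [eich]; ring

end mat

/-! ### Arithmetic -/

lemma arith_count (q₀ n I0 A : ℕ) (h2 : 2 ≤ q₀) (hn : 1 ≤ n)
    (e1 : I0 + (q₀ - 1) * A = (q₀ ^ n) ^ 2) (e2 : ((I0 : ℤ) - A) ^ 2 = ((q₀ : ℤ) ^ n) ^ 2)
    (e3 : (q₀ ^ 2 - 1) ∣ (q₀ - 1) * A) :
    (A : ℤ) = (q₀ : ℤ) ^ (n - 1) * ((q₀ : ℤ) ^ n - (-1) ^ n) ∧
    (I0 : ℤ) - 1 = ((q₀ : ℤ) ^ n - (-1) ^ n) * ((q₀ : ℤ) ^ (n - 1) + (-1) ^ n) := by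
  obtain ⟨s, rfl⟩ : ∃ s, q₀ = s + 1 := ⟨q₀ - 1, by omega⟩
  obtain ⟨m, rfl⟩ : ∃ m, n = m + 1 := ⟨n - 1, by omega⟩
  simp only [Nat.add_sub_cancel] at *
  have hs : 0 < s := by omega
  have hdA : s + 2 ∣ A := by
    have : (s + 1) ^ 2 - 1 = s * (s + 2) := by
      have : (s + 1) ^ 2 = s * (s + 2) + 1 := by ring
      omega
    rw [this] at e3
    exact Nat.dvd_of_mul_dvd_mul_left hs e3
  have hdA' : ((s : ℤ) + 2) ∣ A := by exact_mod_cast hdA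
  have e1' : (I0 : ℤ) + s * A = (((s + 1 : ℕ) : ℤ) ^ (m + 1)) ^ 2 := by exact_mod_cast e1
  push_cast at e1' e2 ⊢
  obtain ⟨Q, hQ⟩ : ∃ Q : ℤ, Q = (s : ℤ) + 1 := ⟨_, rfl⟩
  rw [← hQ] at e1' e2 ⊢
  have hsQ : (s : ℤ) = Q - 1 := by rw [hQ]; ring
  have hQ2 : 2 ≤ Q := by omega
  have hQ0 : Q ≠ 0 := by omega
  obtain ⟨ε, hε⟩ : ∃ ε : ℤ, ε = (-1) ^ (m + 1) := ⟨_, rfl⟩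
  have hεc : ε = 1 ∨ ε = -1 := by rw [hε]; exact neg_one_pow_eq_or ℤ _
  have hNe : Q + 1 ∣ Q ^ (m + 1) - ε := by
    have := sub_dvd_pow_sub_pow Q (-1) (m + 1)
    rwa [sub_neg_eq_add, ← hε] at this
  obtain ⟨M, hM⟩ : ∃ M : ℤ, M = Q ^ m := ⟨_, rfl⟩
  have hcop : IsCoprime (Q + 1) M := by
    rw [hM]; apply IsCoprime.pow_right
    exact ⟨1, -1, by ring⟩
  rw [← hε]
  rw [pow_succ Q m, ← hM] at e1' e2 hNe ⊢
  rw [hsQ] at e1' hdA'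
  have key : ∀ σ : ℤ, σ = 1 ∨ σ = -1 → (I0 : ℤ) - A = σ * (M * Q) → σ = ε ∧ (A : ℤ) = M * (M * Q - σ) := by
    intro σ hσ hIA
    have hA : (A : ℤ) = M * (M * Q - σ) := by
      apply mul_left_cancel₀ hQ0
      linear_combination e1' - hIA
    refine ⟨?_, hA⟩
    rw [hA] at hdA'
    have h3 : Q + 1 ∣ M * Q - σ := hcop.dvd_of_dvd_mul_left (by rwa [show Q - 1 + 2 = Q + 1 by ring] at hdA')
    have h4 : Q + 1 ∣ σ - ε := by
      have := dvd_sub hNe h3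
      rwa [show M * Q - ε - (M * Q - σ) = σ - ε by ring] at this
    rcases hσ with rfl | rfl <;> rcases hεc with h | h <;> rw [h] at h4 ⊢
    · have := Int.le_of_dvd (by norm_num) h4; omega
    · have := Int.le_of_dvd (by norm_num) ((dvd_neg).2 h4); omega
  have hε2 : ε * ε = 1 := by rcases hεc with h | h <;> rw [h] <;> norm_num
  have : ∃ σ : ℤ, (σ = 1 ∨ σ = -1) ∧ (I0 : ℤ) - A = σ * (M * Q) := by
    rcases sq_eq_sq_iff_eq_or_eq_neg.1 e2 with h | h
    · exact ⟨1, Or.inl rfl, by rw [h]; ring⟩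
    · exact ⟨-1, Or.inr rfl, by rw [h]; ring⟩
  obtain ⟨σ, hσ, hIA⟩ := this
  obtain ⟨rfl, hA⟩ := key σ hσ hIA
  refine ⟨hA, ?_⟩
  linear_combination hIA + hA + hε2

lemma arith_two (q₀ k r b i j : ℕ) (h2 : 2 ≤ q₀) (hk2 : 2 < k) (hkr : k ≤ r)
    (e1 : (r : ℤ) * (k - 1) = 2 * ((q₀ : ℤ) ^ 4 - 1))
    (e2 : b * k = q₀ ^ 4 * r)
    (e3 : (r : ℤ) * i = 2 * (((q₀ : ℤ) ^ 2 - 1) * (q₀ + 1)))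
    (e4 : (r : ℤ) * j = 2 * (((q₀ : ℤ) - 1) * (q₀ * ((q₀ : ℤ) ^ 2 - 1)))) :
    (q₀ = 2 ∧ k = 6 ∧ r = 6) ∨ (q₀ = 3 ∧ k = 6 ∧ r = 32) := by
  obtain ⟨Q, hQ⟩ : ∃ Q : ℤ, Q = (q₀ : ℤ) := ⟨_, rfl⟩
  obtain ⟨m, hm⟩ : ∃ m : ℤ, m = (j : ℤ) - (Q - 2) * i := ⟨_, rfl⟩
  rw [← hQ] at e1 e3 e4
  have hQ2 : 2 ≤ Q := by omega
  obtain ⟨N, hN⟩ : ∃ N : ℤ, N = Q ^ 2 := ⟨_, rfl⟩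
  have hN4 : 4 ≤ N := by rw [hN]; nlinarith
  have hk2' : (2 : ℤ) < k := by exact_mod_cast hk2
  have hkr' : (k : ℤ) ≤ r := by exact_mod_cast hkr
  have hrm : (r : ℤ) * m = 4 * (N - 1) := by
    rw [hm, hN]; linear_combination e4 - (Q - 2) * e3
  have hkm : 2 * ((k : ℤ) - 1) = m * (N + 1) := by
    have h : (N - 1) ≠ 0 := by omega
    apply mul_left_cancel₀ h
    apply mul_left_cancel₀ (two_ne_zero (α := ℤ))
    rw [show Q ^ 4 = N ^ 2 by rw [hN]; ring] at e1
    linear_combination m * e1 - (k - 1) * hrm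
  have hm1 : 1 ≤ m := by
    by_contra h
    have : m ≤ 0 := by omega
    nlinarith
  have hm2 : m ≤ 2 := by
    by_contra h
    have h3 : 3 ≤ m := by omega
    have : m * k ≤ 4 * (N - 1) := by rw [← hrm]; nlinarith
    nlinarith
  have hdvd : (k : ℤ) ∣ N ^ 2 * r := by
    refine ⟨b, ?_⟩
    have : (b : ℤ) * k = (q₀ : ℤ) ^ 4 * r := by exact_mod_cast e2
    rw [hN, hQ]; linear_combination -this
  obtain rfl | rfl : m = 1 ∨ m = 2 := by omega
  · have hr : (r : ℤ) = 4 * (N - 1) := by linarith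
    have hNk : N = 2 * k - 3 := by linarith
    have h144 : (k : ℤ) ∣ 144 := by
      have : (144 : ℤ) = k * (4 * (8 * k ^ 2 - 40 * k + 66)) - N ^ 2 * r := by
        rw [hr, hNk]; ring
      rw [this]
      exact dvd_sub (Dvd.intro _ rfl) hdvd
    have hle := Int.le_of_dvd (by norm_num) h144
    have hq16 : q₀ ≤ 16 := by
      by_contra h
      have : 17 ≤ Q := by omega
      nlinarith
    have h144' : k ∣ 144 := by exact_mod_cast h144
    have hk' : 2 * k = q₀ ^ 2 + 3 := by
      have : (2 * k : ℤ) = (q₀ : ℤ) ^ 2 + 3 := by rw [← hQ, ← hN]; linarith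
      exact_mod_cast this
    have hr' : r + 4 = 4 * q₀ ^ 2 := by
      have : (r + 4 : ℤ) = 4 * (q₀ : ℤ) ^ 2 := by rw [← hQ, ← hN]; linarith
      exact_mod_cast this
    have hkeq : k = (q₀ ^ 2 + 3) / 2 := by omega
    clear hdvd h144 hle hkm hrm hm e1 e3 e4 e2 hQ hN hNk hr
    interval_cases q₀ <;> simp at hkeq <;> subst hkeq <;> first
      | omega
      | (exfalso; revert h144'; decide)
  · have hr : (r : ℤ) = 2 * (N - 1) := by linarith
    have hNk : N = k - 2 := by linarith
    have h24 : (k : ℤ) ∣ 24 := by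
      have : (24 : ℤ) = k * (2 * (k ^ 2 - 7 * k + 16)) - N ^ 2 * r := by
        rw [hr, hNk]; ring
      rw [this]
      exact dvd_sub (Dvd.intro _ rfl) hdvd
    have hle := Int.le_of_dvd (by norm_num) h24
    have hq4 : q₀ ≤ 4 := by
      by_contra h
      have : 5 ≤ Q := by omega
      nlinarith
    have h24' : k ∣ 24 := by exact_mod_cast h24
    have hk' : k = q₀ ^ 2 + 2 := by
      have : (k : ℤ) = (q₀ : ℤ) ^ 2 + 2 := by rw [← hQ, ← hN]; linarith
      exact_mod_cast this
    have hr' : r + 2 = 2 * q₀ ^ 2 := by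
      have : (r + 2 : ℤ) = 2 * (q₀ : ℤ) ^ 2 := by rw [← hQ, ← hN]; linarith
      exact_mod_cast this
    clear hdvd h24 hle hkm hrm hm e1 e3 e4 e2 hQ hN hNk hr
    interval_cases q₀ <;> subst hk' <;> first
      | omega
      | (exfalso; revert h24'; decide)

lemma arith_three_small (Q D r i γ : ℤ) (hQ2 : 2 ≤ Q) (hD : D = (Q * Q ^ 2 - -1) * (Q ^ 2 + -1))
    (hmain : 7 * (Q ^ 2) ^ 3 ≤ 20 * D) (hg : Q * γ = (Q ^ 2) ^ 2) (hr2 : 2 < r)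
    (hrr : 2 * (Q * Q ^ 2) ^ 2 ≤ r ^ 2) (e3 : r * i = 2 * D) (hγ : γ ≤ 2 * i) : False := by
  have hQ3 : Q < 3 := by
    by_contra h
    have h3 : 3 ≤ Q := by omega
    have hDle : D ≤ Q ^ 5 := by
      have : Q ^ 2 * 1 ≤ Q ^ 2 * Q := mul_le_mul_of_nonneg_left (by omega) (by positivity)
      have h5 : D = Q ^ 5 + Q ^ 2 - Q ^ 2 * Q - 1 := by rw [hD]; ring
      linarith
    have h6 : (Q ^ 2) ^ 3 = Q ^ 5 * Q := by ring
    have h50 : 0 < Q ^ 5 := by positivity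
    have h7 : Q ^ 5 * 3 ≤ Q ^ 5 * Q := mul_le_mul_of_nonneg_left h3 h50.le
    linarith
  obtain rfl : Q = 2 := by omega
  norm_num at hD hg hrr
  have hi4 : 4 ≤ i := by omega
  rw [hD] at e3
  have hr13 : r ≤ 13 := by nlinarith
  have hr12 : 12 ≤ r := by nlinarith
  have : r = 12 ∨ r = 13 := by omega
  rcases this with h | h <;> rw [h] at e3 <;> omega

lemma arith_three_big (Q M D ε : ℤ) (hQ2 : 2 ≤ Q) (hM3 : Q ^ 3 ≤ M) (hε : ε = 1 ∨ ε = -1)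
    (hD : D = (Q * M - ε) * (M + ε)) (hmain : 7 * M ^ 3 ≤ 20 * D) : False := by
  have hMQ : 4 * Q ≤ M := by
    have : 4 * Q ≤ Q ^ 3 := by
      have : Q ^ 3 = Q ^ 2 * Q := by ring
      have : 4 ≤ Q ^ 2 := by nlinarith
      nlinarith
    omega
  have hM8 : 8 ≤ M := by omega
  have hQM : M * 1 ≤ M * Q := mul_le_mul_of_nonneg_left (by omega) (by omega)
  have hDle : D ≤ (Q * M) * (M + 1) := by
    rcases hε with h | h <;> rw [hD, h] <;> nlinarith
  have h4 : (4 * Q) * (M * (M + 1)) ≤ M * (M * (M + 1)) :=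
    mul_le_mul_of_nonneg_right hMQ (by positivity)
  have h3 : M ^ 3 = M * (M * M) := by ring
  have h5 : M * M * 8 ≤ M * M * M := mul_le_mul_of_nonneg_left hM8 (by positivity)
  have h6 : 0 < M * M := by positivity
  nlinarith

lemma arith_three (q₀ n k r i γ : ℕ) (h2 : 2 ≤ q₀) (hn : 3 ≤ n) (hr2 : 2 < r) (hkr : k ≤ r)
    (e1 : (r : ℤ) * (k - 1) = 2 * (((q₀ : ℤ) ^ n) ^ 2 - 1))
    (e3 : (r : ℤ) * i = 2 * (((q₀ : ℤ) ^ n - (-1) ^ n) * ((q₀ : ℤ) ^ (n - 1) + (-1) ^ n)))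
    (e5 : q₀ ^ 2 * (q₀ * γ) = (q₀ ^ n) ^ 2) (hγ : γ ≤ 2 * i) : False := by
  obtain ⟨m, rfl⟩ : ∃ m, n = m + 3 := ⟨n - 3, by omega⟩
  obtain ⟨Q, hQ⟩ : ∃ Q : ℤ, Q = (q₀ : ℤ) := ⟨_, rfl⟩
  have hQ2 : 2 ≤ Q := by omega
  have e5' : (q₀ : ℤ) ^ 2 * (q₀ * γ) = ((q₀ : ℤ) ^ (m + 3)) ^ 2 := by exact_mod_cast e5
  have hγ' : (γ : ℤ) ≤ 2 * i := by exact_mod_cast hγ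
  have hr2' : (2 : ℤ) < r := by exact_mod_cast hr2
  have hkr' : (k : ℤ) ≤ r := by exact_mod_cast hkr
  have hi0 : (0 : ℤ) ≤ i := by positivity
  have hγ0 : (0 : ℤ) ≤ γ := by positivity
  rw [show m + 3 - 1 = m + 2 by omega] at e3
  rw [← hQ] at e1 e3 e5'
  obtain ⟨M, hM⟩ : ∃ M : ℤ, M = Q ^ (m + 2) := ⟨_, rfl⟩
  have hN : Q ^ (m + 3) = Q * M := by rw [hM]; ring
  rw [hN] at e1 e3 e5'
  rw [← hM] at e3
  have hM4 : Q ^ 2 ≤ M := by rw [hM]; exact pow_le_pow_right₀ (by omega) (by omega)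
  have hM0 : 4 ≤ M := by nlinarith
  have hg : Q * γ = M ^ 2 := by
    apply mul_left_cancel₀ (show Q ^ 2 ≠ 0 by positivity)
    linear_combination e5'
  have hrr : 2 * (Q * M) ^ 2 ≤ (r : ℤ) ^ 2 := by nlinarith
  have h7 : 7 * (Q * M) ≤ 5 * r := by
    by_contra hc
    push Not at hc
    have : (5 * (r : ℤ)) ^ 2 < (7 * (Q * M)) ^ 2 := by
      apply pow_lt_pow_left₀ hc (by positivity) (by norm_num)
    have : 0 ≤ (Q * M) ^ 2 := by positivity
    nlinarith
  obtain ⟨ε, hε⟩ : ∃ ε : ℤ, ε = (-1) ^ (m + 3) := ⟨_, rfl⟩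
  rw [← hε] at e3
  obtain ⟨D, hD⟩ : ∃ D : ℤ, D = (Q * M - ε) * (M + ε) := ⟨_, rfl⟩
  rw [← hD] at e3
  have hmain : 7 * M ^ 3 ≤ 20 * D := by
    have a1 : 7 * (Q * M) * (Q * γ) ≤ 5 * r * (Q * (2 * i)) := by
      apply mul_le_mul h7 _ (by positivity) (by positivity)
      apply mul_le_mul_of_nonneg_left hγ' (by positivity)
    have a2 : Q * (7 * M ^ 3) ≤ Q * (20 * D) := by
      rw [hg] at a1
      calc Q * (7 * M ^ 3) = 7 * (Q * M) * M ^ 2 := by ring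
        _ ≤ _ := a1
        _ = Q * (10 * (r * i)) := by ring
        _ = _ := by rw [e3]; ring
    exact le_of_mul_le_mul_left a2 (by omega)
  rcases Nat.eq_zero_or_pos m with rfl | hm
  · have hε' : ε = -1 := by rw [hε]; norm_num
    have hM' : M = Q ^ 2 := by rw [hM]
    rw [hM'] at hD hmain hg hrr
    rw [hε'] at hD
    exact arith_three_small Q D r i γ hQ2 hD hmain hg hr2' hrr e3 hγ'
  · have : Q ^ 3 ≤ M := by rw [hM]; exact pow_le_pow_right₀ (by omega) (by omega)
    exact arith_three_big Q M D ε hQ2 this (by rw [hε]; exact neg_one_pow_eq_or ℤ _) hD hmain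

/-! ### Assembling -/

section final
variable {K V : Type*} [Field K] [Fintype K] [DecidableEq K] [AddCommGroup V] [Module K V]
  [Fintype V] [DecidableEq V] {φ : K →+* K} {h : V → V → K}

lemma iso_step (H : Herm φ h) (S G₀ : Subgroup (Equiv.Perm V))
    (hS1 : ∀ s ∈ S, ∀ x y, h (s x) (s y) = h x y)
    (hS2 : ∀ x z β, h x x = 0 → h x z = 0 → β + φ β = h z z →
      ∃ s ∈ S, ∀ u, s u = eich h x z β u)
    (hnorm : ∀ g ∈ G₀, ∀ s ∈ S, g * s * g⁻¹ ∈ S)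
    (hsemi : ∀ g ∈ G₀, IsSemilinearPerm K g)
    (hl : ∃ l : K, l ≠ 0 ∧ φ l = -l) :
    ∀ g ∈ G₀, ∀ x, h x x = 0 → h (g x) (g x) = 0 := by
  intro g hg x hx
  obtain ⟨hadd, τ, hτ⟩ := hsemi g hg
  obtain ⟨l, hl0, hl⟩ := hl
  have hg0 : g 0 = 0 := by
    have := hadd 0 0
    simpa using this
  by_cases hx0 : x = 0
  · rw [hx0, hg0]; exact H.zeror 0
  obtain ⟨u, hu⟩ := H.nd x hx0
  obtain ⟨s, hs, hse⟩ := hS2 x 0 l hx (H.zeror x) (by rw [hl, H.zeror]; ring)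
  have ht := hS1 _ (hnorm g hg s hs) (g x) (g u)
  have hgi : ∀ y, g⁻¹ (g y) = y := fun y => by simp
  simp only [Equiv.Perm.coe_mul, Function.comp_apply, hgi] at ht
  have e1 : s x = x := by rw [hse]; exact eich_self h hx (H.zerol x)
  have e2 : s u = u + (-(l * h x u)) • x := by
    rw [hse]; simp only [eich, smul_zero, add_zero, H.zerol, zero_add, neg_smul]
    exact sub_eq_add_neg _ _
  rw [e1, e2, hadd, hτ, H.addr, H.smulr] at ht
  have h3 : τ (-(l * h x u)) * h (g x) (g x) = 0 := by linear_combination ht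
  rcases mul_eq_zero.1 h3 with h4 | h4
  · exfalso
    rw [map_eq_zero_iff _ τ.injective, neg_eq_zero] at h4
    exact mul_ne_zero hl0 hu h4
  · exact h4

lemma block_perp (H : Herm φ h) (𝓑 : Finset (Finset V)) (S : Subgroup (Equiv.Perm V))
    (hlam : ∀ x y : V, x ≠ y → (𝓑.filter (fun B => x ∈ B ∧ y ∈ B)).card = 2)
    (hSinv : ∀ B ∈ 𝓑, ∀ s ∈ S, B.image s ∈ 𝓑)
    (hS2 : ∀ x z β, h x x = 0 → h x z = 0 → β + φ β = h z z →
      ∃ s ∈ S, ∀ u, s u = eich h x z β u) (i : ℕ)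
    (hi : ∀ B ∈ 𝓑, (0 : V) ∈ B →
      (B ∩ Finset.univ.filter (fun x : V => x ≠ 0 ∧ h x x = 0)).card = i)
    (hγ : ∀ x : V, x ≠ 0 → h x x = 0 → ∀ c : K, c ≠ 0 →
      ¬ (Finset.univ.filter (fun y : V => h x y = c ∧ h y y = 0)).card ≤ 2 * i) :
    ∀ B ∈ 𝓑, (0 : V) ∈ B → ∀ x ∈ B, h x x = 0 → ∀ y ∈ B, h y y = 0 → h x y = 0 := by
  intro B hB h0 x hxB hx y hyB hy
  by_contra hc
  have hx0 : x ≠ 0 := by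
    rintro rfl
    exact hc (H.zerol y)
  apply hγ x hx0 hx _ hc
  rw [← hlam 0 x hx0.symm]
  have hsub : (Finset.univ.filter (fun y' : V => h x y' = h x y ∧ h y' y' = 0)) ⊆
      (𝓑.filter (fun B => (0 : V) ∈ B ∧ x ∈ B)).biUnion
        (fun B => B ∩ Finset.univ.filter (fun x : V => x ≠ 0 ∧ h x x = 0)) := by
    intro y' hy'
    simp only [Finset.mem_filter, Finset.mem_univ, true_and] at hy'
    obtain ⟨z, β, hz, hβ, he⟩ := eich_trans H hx hc hy'.1 (by rw [hy'.2, hy])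
    obtain ⟨s, hs, hse⟩ := hS2 x z β hx hz hβ
    have hy0 : y' ≠ 0 := by
      rintro rfl
      apply hc
      rw [← hy'.1, H.zeror]
    simp only [Finset.mem_biUnion, Finset.mem_filter, Finset.mem_inter, Finset.mem_univ, true_and]
    refine ⟨B.image s, ⟨hSinv B hB s hs, ?_, ?_⟩, ?_, hy0, hy'.2⟩
    · refine Finset.mem_image.2 ⟨0, h0, ?_⟩
      rw [hse]; simp [eich, H.zeror]
    · refine Finset.mem_image.2 ⟨x, hxB, ?_⟩
      rw [hse]; exact eich_self h hx (H.symm0 hz)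
    · exact Finset.mem_image.2 ⟨y, hyB, by rw [hse, he]⟩
  refine (Finset.card_le_card hsub).trans ?_
  apply Finset.card_biUnion_le_card_mul
  intro C hC
  simp only [Finset.mem_filter] at hC
  exact (hi C hC.1 hC.2.1).le

lemma block_false (H : Herm φ h) (hT : ∀ d, φ d = d → ∃ b, b + φ b = d)
    (hN : ∀ d : K, d ≠ 0 → φ d = d → ∃ b, b ≠ 0 ∧ b * φ b = d)
    (hl : ∃ l : K, l ≠ 0 ∧ φ l = -l)
    (hdim : ∀ a b : V, ∃ v, v ∉ Submodule.span K {a, b})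
    (𝓑 : Finset (Finset V)) (S : Subgroup (Equiv.Perm V))
    (hlam : ∀ x y : V, x ≠ y → (𝓑.filter (fun B => x ∈ B ∧ y ∈ B)).card = 2)
    (hSinv : ∀ B ∈ 𝓑, ∀ s ∈ S, B.image s ∈ 𝓑)
    (hS2 : ∀ x z β, h x x = 0 → h x z = 0 → β + φ β = h z z →
      ∃ s ∈ S, ∀ u, s u = eich h x z β u)
    (hperp : ∀ B ∈ 𝓑, (0 : V) ∈ B → ∀ x ∈ B, h x x = 0 → ∀ y ∈ B, h y y = 0 → h x y = 0)
    (B : Finset V) (hB : B ∈ 𝓑) (h0 : (0 : V) ∈ B) (x w : V) (hxB : x ∈ B) (hwB : w ∈ B)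
    (hx0 : x ≠ 0) (hx : h x x = 0) (hw : h w w ≠ 0) : False := by
  obtain ⟨e, e', l, l', he, he', hle, hle', hew, hew', n1, n2, n3⟩ :=
    exists_three H hT hN hl hdim hw hx hx0
  have hb : l + φ l = h (0 : V) 0 := by rw [hle, H.zeror]
  have hb' : l' + φ l' = h (0 : V) 0 := by rw [hle', H.zeror]
  obtain ⟨s, hs, hse⟩ := hS2 e 0 l he (H.zeror e) hb
  obtain ⟨s', hs', hse'⟩ := hS2 e' 0 l' he' (H.zeror e') hb'
  have p1 : h (eich h e 0 l x) (eich h e 0 l x) = 0 := by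
    rw [eich_pres H he (H.zeror e) hb, hx]
  have p2 : h (eich h e' 0 l' x) (eich h e' 0 l' x) = 0 := by
    rw [eich_pres H he' (H.zeror e') hb', hx]
  have hw0 : (0 : V) ≠ w := by
    rintro rfl
    exact hw (H.zeror 0)
  have z1 : (0 : V) ∈ B.image s := Finset.mem_image.2 ⟨0, h0, by rw [hse]; simp [eich, H.zeror]⟩
  have z2 : (0 : V) ∈ B.image s' := Finset.mem_image.2 ⟨0, h0, by rw [hse']; simp [eich, H.zeror]⟩
  have w1 : w ∈ B.image s := Finset.mem_image.2 ⟨w, hwB, by rw [hse, hew]⟩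
  have w2 : w ∈ B.image s' := Finset.mem_image.2 ⟨w, hwB, by rw [hse', hew']⟩
  have x1 : eich h e 0 l x ∈ B.image s := Finset.mem_image.2 ⟨x, hxB, by rw [hse]⟩
  have x2 : eich h e' 0 l' x ∈ B.image s' := Finset.mem_image.2 ⟨x, hxB, by rw [hse']⟩
  have b1 := hSinv B hB s hs
  have b2 := hSinv B hB s' hs'
  have hcard := hlam 0 w hw0
  have : ¬ 2 < (𝓑.filter (fun B => (0 : V) ∈ B ∧ w ∈ B)).card := by omega
  apply this
  rw [Finset.two_lt_card]
  refine ⟨B, Finset.mem_filter.2 ⟨hB, h0, hwB⟩, B.image s, Finset.mem_filter.2 ⟨b1, z1, w1⟩,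
    B.image s', Finset.mem_filter.2 ⟨b2, z2, w2⟩, ?_, ?_, ?_⟩
  · intro heq
    rw [← heq] at x1
    exact n1 (hperp B hB h0 x hxB hx _ x1 p1)
  · intro heq
    rw [← heq] at x2
    exact n2 (hperp B hB h0 x hxB hx _ x2 p2)
  · intro heq
    rw [← heq] at x2
    exact n3 (hperp _ b1 z1 _ x1 p1 _ x2 p2)

end final

/-- Let `q = q₀²`, `V = GF(q)^n` (`n ≥ 2`), and let `D` be a nontrivial
2-(q^n,k,2) design with even `r` admitting a flag-transitive, point-primitive
`G = T ⋊ G₀` with `G₀ ≤ ΓL_n(q)`, `n` minimal, where `G₀` contains `SU_n(q₀)` as a normal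
subgroup.  Then `n = 2` and `(q₀,v,k,r) = (2,16,6,6)` or `(3,81,6,32)`. -/
theorem stmt_17 (q₀ : ℕ) (K : Type*) [Field K] [Fintype K] [DecidableEq K]
    (hq₀ : Fintype.card K = q₀ ^ 2) (n : ℕ) (hn : 2 ≤ n)
    (𝓑 : Finset (Finset (Fin n → K))) (k r : ℕ)
    (G₀ : Subgroup (Equiv.Perm (Fin n → K)))
    (hk : ∀ B ∈ 𝓑, B.card = k)
    (hlam : ∀ x y : Fin n → K, x ≠ y →
      (𝓑.filter (fun B => x ∈ B ∧ y ∈ B)).card = 2)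
    (hr : ∀ x : Fin n → K, (𝓑.filter (fun B => x ∈ B)).card = r)
    (hk2 : 2 < k) (hkv : k < Fintype.card (Fin n → K))
    (hreven : Even r)
    (hsemi : ∀ g ∈ G₀, IsSemilinearPerm K g)
    (hinv : ∀ B ∈ 𝓑, ∀ g ∈ G₀, ∀ v : Fin n → K,
      B.image (fun x => g x + v) ∈ 𝓑)
    (hflag : ∀ B ∈ 𝓑, ∀ C ∈ 𝓑, ∀ x ∈ B, ∀ y ∈ C,
      ∃ g ∈ G₀, ∃ v : Fin n → K,
        B.image (fun z => g z + v) = C ∧ g x + v = y)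
    -- point-primitivity: `G₀` is irreducible over the prime field
    (hprim : ∀ W : AddSubgroup (Fin n → K),
      (∀ g ∈ G₀, ∀ x ∈ W, g x ∈ W) → W = ⊥ ∨ W = ⊤)
    -- minimality of `n`: there is no larger-field structure on `V` over which every
    -- element of `G₀` is semilinear and the dimension is smaller
    (hmin : ∀ (L : Type) [Field L] [Module L (Fin n → K)] (f : K →+* L),
      (∀ (c : K) (x : Fin n → K), f c • x = c • x) →
      (∀ g ∈ G₀, (∀ x y : Fin n → K, g (x + y) = g x + g y) ∧
        ∃ τ : L ≃+* L, ∀ (c : L) (x : Fin n → K), g (c • x) = τ c • g x) →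
      n ≤ Module.finrank L (Fin n → K))
    -- `G₀` contains `SU_n(q₀)` as a normal subgroup
    (hSU : ∃ J : Matrix (Fin n) (Fin n) K, IsUnit J.det ∧
      (J.map (fun c => c ^ q₀))ᵀ = J ∧
      ∃ S : Subgroup (Equiv.Perm (Fin n → K)), S ≤ G₀ ∧
        (∀ g ∈ G₀, ∀ s ∈ S, g * s * g⁻¹ ∈ S) ∧
        (S : Set (Equiv.Perm (Fin n → K))) =
          {σ | ∃ M : Matrix (Fin n) (Fin n) K, M.det = 1 ∧
            (M.map (fun c => c ^ q₀))ᵀ * J * M = J ∧ ∀ x, σ x = M.mulVec x}) :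
    n = 2 ∧ ((q₀ = 2 ∧ k = 6 ∧ r = 6) ∨ (q₀ = 3 ∧ k = 6 ∧ r = 32)) := by
  obtain ⟨h2, φ, hφ, hφφ⟩ := exists_conj K q₀ hq₀
  obtain ⟨hF, hT, hl⟩ := field_trace hq₀ h2 hφ hφφ
  have hN : ∀ d : K, d ≠ 0 → φ d = d → ∃ b, b ≠ 0 ∧ b * φ b = d :=
    fun d hd0 hd => field_norm hq₀ h2 hφ d hd0 hd
  obtain ⟨J, hJ, hJs, S, hSG, hnorm, hSeq⟩ := hSU
  have hfun : (fun c : K => c ^ q₀) = φ := by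
    funext c; exact (hφ c).symm
  rw [hfun] at hJs hSeq
  have H : Herm φ (mform φ J) := mform_herm J hφφ hJ hJs
  have hS1 : ∀ s ∈ S, ∀ x y, mform φ J (s x) (s y) = mform φ J x y := by
    intro s hs x y
    have : s ∈ (S : Set (Equiv.Perm (Fin n → K))) := hs
    rw [hSeq] at this
    obtain ⟨M, -, hM, hMs⟩ := this
    rw [hMs, hMs]
    exact (mform_pres J M).1 hM x y
  have hS2 : ∀ x z β, mform φ J x x = 0 → mform φ J x z = 0 → β + φ β = mform φ J z z →
      ∃ s ∈ S, ∀ u, s u = eich (mform φ J) x z β u := by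
    intro x z β hx hxz hβ
    obtain ⟨M, hdet, hM⟩ := eich_matrix J H x z β hx hxz
    have hinj : Function.Injective (fun u => M *ᵥ u) := by
      intro u v huv
      have := congrArg (fun t => M⁻¹ *ᵥ t) huv
      simpa [Matrix.mulVec_mulVec, Matrix.nonsing_inv_mul M (by rw [hdet]; exact isUnit_one)]
        using this
    refine ⟨Equiv.ofBijective _ (Finite.injective_iff_bijective.1 hinj), ?_, fun u => hM u⟩
    change _ ∈ (S : Set (Equiv.Perm (Fin n → K)))
    rw [hSeq]
    refine ⟨M, hdet, ?_, fun x => rfl⟩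
    rw [mform_pres]
    intro u v
    rw [hM, hM]
    exact eich_pres H hx hxz hβ u v
  have hg0 : ∀ g ∈ G₀, g 0 = 0 := by
    intro g hg
    have := (hsemi g hg).1 0 0
    simpa using this
  have hiso1 := iso_step H S G₀ hS1 hS2 hnorm hsemi hl
  have hiso : ∀ g ∈ G₀, ∀ x, mform φ J (g x) (g x) = 0 ↔ mform φ J x x = 0 := by
    intro g hg x
    refine ⟨fun hx => ?_, hiso1 g hg x⟩
    have := hiso1 g⁻¹ (inv_mem hg) (g x) hx
    simpa using this
  have hSinv : ∀ B ∈ 𝓑, ∀ s ∈ S, B.image s ∈ 𝓑 := by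
    intro B hB s hs
    have := hinv B hB s (hSG hs) 0
    simpa using this
  have hVcard : Fintype.card (Fin n → K) = (q₀ ^ n) ^ 2 := by
    rw [Fintype.card_fun, hq₀, Fintype.card_fin]; ring
  -- counts
  obtain ⟨A, c1, c2, c3⟩ := card_iso (V := Fin n → K) H h2 hF hT hN
  have hdvd := scal_dvd (K := K)
    (Finset.univ.filter (fun z : Fin n → K => mform φ J z z ≠ 0))
    (by simp [H.zeror]) (by
      intro c hc x hx
      simp only [Finset.mem_filter, Finset.mem_univ, true_and] at hx ⊢
      rw [H.smulr, H.smull]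
      exact mul_ne_zero hc (mul_ne_zero (by simpa using hc) hx))
  rw [c3, hq₀] at hdvd
  rw [hVcard] at c1 c2
  push_cast at c2
  obtain ⟨hA, hI⟩ := arith_count q₀ n _ A h2 (by omega) c1 c2 hdvd
  have hDcard : (((Finset.univ.filter
      (fun x : Fin n → K => x ≠ 0 ∧ mform φ J x x = 0)).card : ℕ) : ℤ) =
      (((q₀ : ℤ) ^ n - (-1) ^ n) * ((q₀ : ℤ) ^ (n - 1) + (-1) ^ n)) := by
    rw [← hI]
    have : (Finset.univ.filter (fun x : Fin n → K => x ≠ 0 ∧ mform φ J x x = 0)) =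
        (Finset.univ.filter (fun x : Fin n → K => mform φ J x x = 0)).erase 0 := by
      ext x; simp
    have h0 : (0 : Fin n → K) ∈ Finset.univ.filter (fun x : Fin n → K => mform φ J x x = 0) := by
      simp [H.zeror]
    rw [this, Finset.card_erase_of_mem h0, Nat.cast_sub (Finset.card_pos.2 ⟨_, h0⟩)]
    simp
  -- orbits
  have hi := fun B hB h0B => design_orbit 𝓑 r G₀ hlam hr hg0 hflag
    (Finset.univ.filter (fun x : Fin n → K => x ≠ 0 ∧ mform φ J x x = 0)) (by simp)
    (by
      intro g hg x
      simp only [Finset.mem_filter, Finset.mem_univ, true_and, hiso g hg x]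
      have : g x = 0 ↔ x = 0 := by
        constructor
        · intro hx
          apply g.injective
          rw [hx, hg0 g hg]
        · rintro rfl; exact hg0 g hg
      rw [Ne, this]) B hB h0B
  have hj := fun B hB h0B => design_orbit 𝓑 r G₀ hlam hr hg0 hflag
    (Finset.univ.filter (fun x : Fin n → K => mform φ J x x ≠ 0)) (by simp [H.zeror])
    (by
      intro g hg x
      simp only [Finset.mem_filter, Finset.mem_univ, true_and, Ne, hiso g hg x]) B hB h0B
  -- a block through zero
  obtain ⟨B, hB, h0B⟩ : ∃ B ∈ 𝓑, (0 : Fin n → K) ∈ B := by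
    have hne : (0 : Fin n → K) ≠ fun _ => 1 := by
      intro h
      have := congrFun h ⟨0, by omega⟩
      simp at this
    have h3 := hlam 0 _ hne
    obtain ⟨B, hB⟩ := Finset.card_pos.1 (by rw [h3]; norm_num)
    simp only [Finset.mem_filter] at hB
    exact ⟨B, hB.1, hB.2.1⟩
  obtain ⟨hkr, hr2⟩ := design_fisher 𝓑 k r hk hlam hr hk2 hkv B hB
  have hrk := design_rk 𝓑 k r hk hlam hr 0 (by omega)
  have hbk := design_bk 𝓑 k r hk hr
  rw [hVcard] at hrk hbk
  have hrk' : (r : ℤ) * (k - 1) = 2 * (((q₀ : ℤ) ^ n) ^ 2 - 1) := by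
    have hp : 1 ≤ (q₀ ^ n) ^ 2 := Nat.one_le_pow _ _ (Nat.pow_pos (by omega))
    have := congrArg (Nat.cast : ℕ → ℤ) hrk
    push_cast [Nat.cast_sub (show 1 ≤ k by omega), Nat.cast_sub hp] at this
    exact this
  have hiB := hi B hB h0B
  have hjB := hj B hB h0B
  have hiB' := congrArg (Nat.cast : ℕ → ℤ) hiB
  push_cast only [Nat.cast_mul, Nat.cast_ofNat] at hiB'
  rw [hDcard] at hiB'
  rw [c3] at hjB
  have hjB' := congrArg (Nat.cast : ℕ → ℤ) hjB
  push_cast [Nat.cast_sub (show 1 ≤ q₀ by omega)] at hjB'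
  rw [hA] at hjB'
  have hn2 : n = 2 := by
    by_contra hne
    have hn3 : 3 ≤ n := by omega
    have hdim : ∀ a b : Fin n → K, ∃ v, v ∉ Submodule.span K {a, b} := by
      intro a b
      by_contra hc
      push Not at hc
      have htop : Submodule.span K {a, b} = ⊤ := Submodule.eq_top_iff'.2 hc
      have h1 := finrank_span_finset_le_card (R := K) ({a, b} : Finset (Fin n → K))
      simp only [Finset.coe_insert, Finset.coe_singleton] at h1
      rw [Set.finrank, htop, finrank_top, Module.finrank_fin_fun] at h1
      have := Finset.card_le_two (a := a) (b := b)
      omega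
    have hconst : ∀ C ∈ 𝓑, (0 : Fin n → K) ∈ C →
        (C ∩ Finset.univ.filter (fun x : Fin n → K => x ≠ 0 ∧ mform φ J x x = 0)).card =
        (B ∩ Finset.univ.filter (fun x : Fin n → K => x ≠ 0 ∧ mform φ J x x = 0)).card := by
      intro C hC h0C
      have := hi C hC h0C
      rw [← hiB] at this
      exact Nat.eq_of_mul_eq_mul_left (by omega) this
    have hperp := block_perp H 𝓑 S hlam hSinv hS2 _ hconst (by
      intro x hx0 hx c hc hle
      have hg := card_gamma H hF hT x hx0 hx c hc
      rw [hq₀, hVcard] at hg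
      exact arith_three q₀ n k r _ _ h2 hn3 hr2 hkr hrk' hiB' hg hle)
    have hQ : (2 : ℤ) ≤ q₀ := by exact_mod_cast h2
    have hM : (2 : ℤ) ≤ (q₀ : ℤ) ^ (n - 1) :=
      hQ.trans (le_self_pow₀ (by omega) (by omega))
    have hNN : (2 : ℤ) ≤ (q₀ : ℤ) ^ n := hQ.trans (le_self_pow₀ (by omega) (by omega))
    have hpos1 : (0 : ℤ) < (q₀ : ℤ) ^ n - (-1) ^ n := by
      rcases neg_one_pow_eq_or ℤ n with h | h <;> rw [h] <;> omega
    have hpos2 : (0 : ℤ) < (q₀ : ℤ) ^ (n - 1) + (-1) ^ n := by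
      rcases neg_one_pow_eq_or ℤ n with h | h <;> rw [h] <;> omega
    have hipos : 0 < (B ∩ Finset.univ.filter
        (fun x : Fin n → K => x ≠ 0 ∧ mform φ J x x = 0)).card := by
      apply Nat.pos_of_ne_zero
      intro h
      rw [h] at hiB'
      have := mul_pos hpos1 hpos2
      push_cast at hiB'
      linarith
    have hjpos : 0 < (B ∩ Finset.univ.filter
        (fun x : Fin n → K => mform φ J x x ≠ 0)).card := by
      apply Nat.pos_of_ne_zero
      intro h
      rw [h] at hjB'
      have := mul_pos (show (0 : ℤ) < (q₀ : ℤ) - 1 by omega)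
        (mul_pos (show (0 : ℤ) < (q₀ : ℤ) ^ (n - 1) by omega) hpos1)
      push_cast at hjB'
      linarith
    obtain ⟨x, hx⟩ := Finset.card_pos.1 hipos
    obtain ⟨w, hw⟩ := Finset.card_pos.1 hjpos
    simp only [Finset.mem_inter, Finset.mem_filter, Finset.mem_univ, true_and] at hx hw
    exact block_false H hT hN hl hdim 𝓑 S hlam hSinv hS2 hperp B hB h0B x w hx.1 hw.1
      hx.2.1 hx.2.2 hw.2
  refine ⟨hn2, ?_⟩
  subst hn2
  refine arith_two q₀ k r 𝓑.card
    (B ∩ Finset.univ.filter (fun x : Fin 2 → K => x ≠ 0 ∧ mform φ J x x = 0)).card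
    (B ∩ Finset.univ.filter (fun x : Fin 2 → K => mform φ J x x ≠ 0)).card h2 hk2 hkr ?_ ?_ ?_ ?_
  · rw [hrk']; ring
  · rw [hbk]; ring
  · rw [hiB']; norm_num
  · rw [hjB']; norm_num
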